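/- arXiv:2106.11235 — 2 statements merged into one kernel-verified Lean document; each statement's English description precedes it below -/
import Mathlib

section
/- Assume (A1)–(A6). Then there exist a real number λ* > 0 and a function u* : (0,1] → ℝ of class C² such that: (i) for every r ∈ (0,1], (r^α |u*'(r)|^β u*'(r))' = − λ* r^γ exp(f(u*(r))) (i.e. L(u*) + λ* e^{f(u*)} = 0); (ii) u*(1) = 0 and u*(r) > 0 for all r ∈ (0,1); (iii) u*(r) → +∞ as r → 0+; (iv) u*(r) − g(Z(r)) = O( g''(−θ ln r) ) as r → 0+, where Z(r) = ln( θ^{β+1}(α−β−1) ) − ln λ* − θ ln r + (β+1) ln( g'(τ(r)) + (β+1) g''(τ(r)) ln g'(τ(r)) ) and τ(r) = ln( (β+1)/(λ* r^θ) ). -/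
open Filter Set Asymptotics Real

/-- The bounded solution operator of `y' = μ y - h` on the line, for `0 < re μ`. -/
noncomputable def expTail (μ : ℂ) (h : ℝ → ℂ) (t : ℝ) : ℂ :=
  Complex.exp (μ * t) * ∫ s in Ioi t, Complex.exp (-μ * s) * h s

lemma norm_cexp_mul_ofReal (μ : ℂ) (t : ℝ) : ‖Complex.exp (μ * t)‖ = Real.exp (μ.re * t) := by
  rw [Complex.norm_exp]
  simp

lemma integrableOn_expTail {μ : ℂ} (hμ : 0 < μ.re) {h : ℝ → ℂ} (hc : Continuous h) {B : ℝ}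
    (hB : ∀ t, ‖h t‖ ≤ B) (t : ℝ) :
    MeasureTheory.IntegrableOn (fun s : ℝ => Complex.exp (-μ * s) * h s) (Ioi t) := by
  have h1 : MeasureTheory.IntegrableOn (fun s : ℝ => Real.exp (-μ.re * s) * B) (Ioi t) :=
    (integrableOn_exp_mul_Ioi (by linarith) t).mul_const B
  refine MeasureTheory.Integrable.mono' h1 (Continuous.aestronglyMeasurable (by fun_prop)) ?_
  refine Filter.Eventually.of_forall fun s => ?_
  rw [norm_mul, norm_cexp_mul_ofReal]
  simpa using mul_le_mul_of_nonneg_left (hB s) (Real.exp_pos (-μ.re * s)).le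

lemma hasDerivAt_expTail {μ : ℂ} (hμ : 0 < μ.re) {h : ℝ → ℂ} (hc : Continuous h) {B : ℝ}
    (hB : ∀ t, ‖h t‖ ≤ B) (t : ℝ) :
    HasDerivAt (expTail μ h) (μ * expTail μ h t - h t) t := by
  have hcont : Continuous fun s : ℝ => Complex.exp (-μ * s) * h s := by fun_prop
  have h1 : ∀ x : ℝ, ∫ s in Ioi x, Complex.exp (-μ * s) * h s
      = (∫ s in Ioi t, Complex.exp (-μ * s) * h s)
        - ∫ s in t..x, Complex.exp (-μ * s) * h s := by
    intro x
    rw [← intervalIntegral.integral_interval_add_Ioi (integrableOn_expTail hμ hc hB t)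
      (integrableOn_expTail hμ hc hB x)]
    ring
  have h2 : HasDerivAt (fun x : ℝ => ∫ s in Ioi x, Complex.exp (-μ * s) * h s)
      (-(Complex.exp (-μ * t) * h t)) t := by
    have h3 := (intervalIntegral.integral_hasDerivAt_right (hcont.intervalIntegrable t t)
      (hcont.stronglyMeasurableAtFilter _ _) hcont.continuousAt).const_sub
        (∫ s in Ioi t, Complex.exp (-μ * s) * h s)
    exact h3.congr_of_eventuallyEq (Filter.Eventually.of_forall h1)
  have h4 : HasDerivAt (fun x : ℝ => Complex.exp (μ * x)) (Complex.exp (μ * t) * μ) t := by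
    have h5 : HasDerivAt (fun x : ℝ => μ * (x : ℂ)) μ t := by
      simpa using (Complex.ofRealCLM.hasDerivAt (x := t)).const_mul μ
    exact h5.cexp
  convert! h4.mul h2 using 1
  have h6 : Complex.exp (μ * t) * Complex.exp (-μ * t) = 1 := by
    rw [← Complex.exp_add]; simp
  unfold expTail
  linear_combination h t * h6

lemma norm_expTail_le {μ : ℂ} {ε : ℝ} (hε : ε < μ.re) {h : ℝ → ℂ} {t K : ℝ}
    (hK : ∀ s, t ≤ s → ‖h s‖ ≤ K * Real.exp (ε * (s - t))) :
    ‖expTail μ h t‖ ≤ K / (μ.re - ε) := by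
  have hint : MeasureTheory.IntegrableOn
      (fun s : ℝ => Real.exp ((ε - μ.re) * s) * (K * Real.exp (-ε * t))) (Ioi t) :=
    (integrableOn_exp_mul_Ioi (by linarith) t).mul_const _
  have h1 : ‖∫ s in Ioi t, Complex.exp (-μ * s) * h s‖
      ≤ ∫ s in Ioi t, Real.exp ((ε - μ.re) * s) * (K * Real.exp (-ε * t)) := by
    refine MeasureTheory.norm_integral_le_of_norm_le hint ?_
    refine (MeasureTheory.ae_restrict_mem measurableSet_Ioi).mono fun s hs => ?_
    rw [norm_mul, norm_cexp_mul_ofReal]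
    calc _ ≤ Real.exp ((-μ).re * s) * (K * Real.exp (ε * (s - t))) :=
          mul_le_mul_of_nonneg_left (hK s (le_of_lt hs)) (Real.exp_pos _).le
      _ = _ := by
          have e1 : Real.exp (ε * (s - t)) = Real.exp (ε * s) * Real.exp (-ε * t) := by
            rw [← Real.exp_add]; ring_nf
          have e2 : Real.exp ((ε - μ.re) * s) = Real.exp (ε * s) * Real.exp ((-μ).re * s) := by
            rw [← Real.exp_add]; simp; ring
          rw [e1, e2]; ring
  rw [MeasureTheory.integral_mul_const, integral_exp_mul_Ioi (by linarith)] at h1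
  unfold expTail
  rw [norm_mul, norm_cexp_mul_ofReal]
  refine (mul_le_mul_of_nonneg_left h1 (Real.exp_pos _).le).trans (le_of_eq ?_)
  have hne : μ.re - ε ≠ 0 := by linarith
  have hne' : ε - μ.re ≠ 0 := by intro h; apply hne; linarith
  have e3 : Real.exp (μ.re * t) * (Real.exp ((ε - μ.re) * t) * Real.exp (-ε * t)) = 1 := by
    rw [← Real.exp_add, ← Real.exp_add]; ring_nf; simp
  calc _ = (Real.exp (μ.re * t) * (Real.exp ((ε - μ.re) * t) * Real.exp (-ε * t)))
        * (-K / (ε - μ.re)) := by ring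
    _ = K / (μ.re - ε) := by
        rw [e3, one_mul, ← neg_sub μ.re ε, neg_div_neg_eq]

lemma expTail_sub {μ : ℂ} (hμ : 0 < μ.re) {h₁ h₂ : ℝ → ℂ} (hc₁ : Continuous h₁)
    (hc₂ : Continuous h₂) {B₁ B₂ : ℝ} (hB₁ : ∀ t, ‖h₁ t‖ ≤ B₁) (hB₂ : ∀ t, ‖h₂ t‖ ≤ B₂) :
    expTail μ (h₁ - h₂) = expTail μ h₁ - expTail μ h₂ := by
  ext t
  simp only [expTail, Pi.sub_apply, mul_sub]
  rw [MeasureTheory.integral_sub (integrableOn_expTail hμ hc₁ hB₁ t)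
    (integrableOn_expTail hμ hc₂ hB₂ t), mul_sub]

/-- A weight which grows at most exponentially, at rate `ε` and up to the factor `C`. -/
def SlowWeight (C ε : ℝ) (ω : ℝ → ℝ) : Prop :=
  ∀ t s, t ≤ s → ω s ≤ C * ω t * Real.exp (ε * (s - t))

lemma norm_expTail_le_weight {μ : ℂ} {C ε : ℝ} (hε : 2 * ε ≤ μ.re) (hμ : 0 < μ.re) {ω : ℝ → ℝ}
    (hω : SlowWeight C ε ω) {h : ℝ → ℂ} {A : ℝ} (hA : 0 ≤ A) (hh : ∀ s, ‖h s‖ ≤ A * ω s) (t : ℝ) :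
    ‖expTail μ h t‖ ≤ (2 * C / μ.re * A) * ω t := by
  have h1 : ‖expTail μ h t‖ ≤ (A * (C * ω t)) / (μ.re - μ.re / 2) := by
    refine norm_expTail_le (by linarith) fun s hs => ?_
    have h2 : 0 ≤ A * (C * ω t) := by
      have := (norm_nonneg _).trans ((hh t).trans (mul_le_mul_of_nonneg_left (hω t t le_rfl) hA))
      simpa using this
    calc ‖h s‖ ≤ A * ω s := hh s
      _ ≤ A * (C * ω t * Real.exp (ε * (s - t))) := mul_le_mul_of_nonneg_left (hω t s hs) hA
      _ = A * (C * ω t) * Real.exp (ε * (s - t)) := by ring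
      _ ≤ _ := by
        refine mul_le_mul_of_nonneg_left (Real.exp_le_exp.2 ?_) h2
        exact mul_le_mul_of_nonneg_right (by linarith) (by linarith)
  refine h1.trans (le_of_eq ?_)
  field_simp
  ring

lemma exists_roots_re_pos {a b : ℝ} (ha : 0 < a) (hb : 0 < b) :
    ∃ μ₁ μ₂ : ℂ, 0 < μ₁.re ∧ 0 < μ₂.re ∧ μ₁ + μ₂ = a ∧ μ₁ * μ₂ = b := by
  have key : ∀ z w : ℂ, z + w = a → z * w = b → 0 < z.re := by
    intro z w h1 h2
    have hw : w = a - z := by linear_combination h1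
    subst hw
    have hre := congrArg Complex.re h2
    have him := congrArg Complex.im h2
    simp at hre him
    have him' : z.im * (a - 2 * z.re) = 0 := by linarith
    rcases mul_eq_zero.1 him' with h | h
    · rw [h] at hre
      nlinarith [sq_nonneg z.re]
    · linarith
  obtain ⟨s, hs⟩ := IsAlgClosed.exists_pow_nat_eq ((a : ℂ) ^ 2 - 4 * b) (n := 2) (by norm_num)
  have h1 : ((a + s) / 2 : ℂ) + (a - s) / 2 = a := by ring
  have h2 : ((a + s) / 2 : ℂ) * ((a - s) / 2) = b := by linear_combination -hs / 4
  exact ⟨(a + s) / 2, (a - s) / 2, key _ _ h1 h2,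
    key _ _ (by rw [add_comm]; exact h1) (by rw [mul_comm]; exact h2), h1, h2⟩

/-- Bounded solutions of `ξ' = η`, `η' = a η - b ξ + h` on the line for `0 < a`, `0 < b`. -/
lemma exists_linear_solution {a b : ℝ} (ha : 0 < a) (hb : 0 < b) :
    ∃ (X Y : (ℝ → ℝ) → ℝ → ℝ) (ε L : ℝ), 0 < ε ∧ 0 < L ∧
      (∀ (h : ℝ → ℝ) (B : ℝ), Continuous h → (∀ t, |h t| ≤ B) → ∀ t,
        HasDerivAt (X h) (Y h t) t ∧ HasDerivAt (Y h) (a * Y h t - b * X h t + h t) t) ∧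
      (∀ (h₁ h₂ : ℝ → ℝ) (B₁ B₂ : ℝ), Continuous h₁ → Continuous h₂ → (∀ t, |h₁ t| ≤ B₁) →
        (∀ t, |h₂ t| ≤ B₂) → X (h₁ - h₂) = X h₁ - X h₂ ∧ Y (h₁ - h₂) = Y h₁ - Y h₂) ∧
      ∀ (h ω : ℝ → ℝ) (A C : ℝ), 0 ≤ A → 1 ≤ C → SlowWeight C ε ω → (∀ t, |h t| ≤ A * ω t) →
        ∀ t, |X h t| ≤ L * C ^ 2 * A * ω t ∧ |Y h t| ≤ L * C ^ 2 * A * ω t := by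
  obtain ⟨μ₁, μ₂, h1, h2, hsum, hprod⟩ := exists_roots_re_pos ha hb
  let k : (ℝ → ℝ) → ℝ → ℂ := fun h => expTail μ₂ fun s => (h s : ℂ)
  let x : (ℝ → ℝ) → ℝ → ℂ := fun h => expTail μ₁ (k h)
  have hcast : ∀ {h : ℝ → ℝ} {B : ℝ}, (∀ t, |h t| ≤ B) → ∀ t, ‖(h t : ℂ)‖ ≤ B := by
    intro h B hB t
    simpa using hB t
  have hone : SlowWeight 1 0 (fun _ => (1 : ℝ)) := by intro t s _; simp
  have hkd : ∀ {h : ℝ → ℝ} {B : ℝ}, Continuous h → (∀ t, |h t| ≤ B) → ∀ t,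
      HasDerivAt (k h) (μ₂ * k h t - h t) t := fun hc hB t =>
    hasDerivAt_expTail h2 (by fun_prop) (hcast hB) t
  have hkc : ∀ {h : ℝ → ℝ} {B : ℝ}, Continuous h → (∀ t, |h t| ≤ B) → Continuous (k h) :=
    fun hc hB => continuous_iff_continuousAt.2 fun t => (hkd hc hB t).continuousAt
  have hkb : ∀ {h : ℝ → ℝ} {B : ℝ}, (∀ t, |h t| ≤ B) → ∀ t, ‖k h t‖ ≤ 2 / μ₂.re * B := by
    intro h B hB t
    have hB0 : 0 ≤ B := (abs_nonneg _).trans (hB 0)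
    simpa using norm_expTail_le_weight (by linarith) h2 hone hB0
      (fun s => by simpa using hB s : ∀ s, ‖((h s : ℝ) : ℂ)‖ ≤ B * 1) t
  have hxd : ∀ {h : ℝ → ℝ} {B : ℝ}, Continuous h → (∀ t, |h t| ≤ B) → ∀ t,
      HasDerivAt (x h) (μ₁ * x h t - k h t) t := fun hc hB t =>
    hasDerivAt_expTail h1 (hkc hc hB) (hkb hB) t
  have hre : ∀ {φ : ℝ → ℂ} {φ' : ℂ} {t : ℝ}, HasDerivAt φ φ' t →
      HasDerivAt (fun s => (φ s).re) φ'.re t := by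
    intro φ φ' t h
    exact Complex.reCLM.hasFDerivAt.comp_hasDerivAt t h
  refine ⟨fun h t => (x h t).re, fun h t => (μ₁ * x h t - k h t).re,
    min (μ₁.re / 2) (μ₂.re / 2),
    4 / (μ₁.re * μ₂.re) + (‖μ₁‖ * (4 / (μ₁.re * μ₂.re)) + 2 / μ₂.re), by positivity,
    by positivity, ?_, ?_, ?_⟩
  · intro h B hc hB t
    refine ⟨hre (hxd hc hB t), ?_⟩
    have h3 := hre (((hxd hc hB t).const_mul μ₁).sub (hkd hc hB t))
    convert! h3 using 1
    have e : μ₁ * (μ₁ * x h t - k h t) - (μ₂ * k h t - h t)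
        = a * (μ₁ * x h t - k h t) - b * x h t + h t := by
      rw [← hsum, ← hprod]; ring
    rw [e]
    simp
  · intro h₁ h₂ B₁ B₂ hc₁ hc₂ hB₁ hB₂
    have e1 : k (h₁ - h₂) = k h₁ - k h₂ := by
      rw [← expTail_sub h2 (by fun_prop) (by fun_prop) (hcast hB₁) (hcast hB₂)]
      exact congrArg (expTail μ₂) (funext fun s => by simp)
    have e2 : x (h₁ - h₂) = x h₁ - x h₂ := by
      change expTail μ₁ (k (h₁ - h₂)) = _
      rw [e1, expTail_sub h1 (hkc hc₁ hB₁) (hkc hc₂ hB₂) (hkb hB₁) (hkb hB₂)]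
    constructor
    · ext t
      simp [e2]
    · ext t
      simp only [e1, e2, Pi.sub_apply]
      rw [← Complex.sub_re]
      congr 1
      ring
  · intro h ω A C hA hC hω hh t
    have hω0 : 0 ≤ A * ω t := (abs_nonneg _).trans (hh t)
    have hk : ∀ s, ‖k h s‖ ≤ (2 * C / μ₂.re * A) * ω s :=
      norm_expTail_le_weight (by linarith [min_le_right (μ₁.re / 2) (μ₂.re / 2)]) h2 hω hA
        (fun s => by simpa using hh s)
    have hx : ‖x h t‖ ≤ (2 * C / μ₁.re * (2 * C / μ₂.re * A)) * ω t :=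
      norm_expTail_le_weight (by linarith [min_le_left (μ₁.re / 2) (μ₂.re / 2)]) h1 hω
        (by positivity) hk t
    have hx' : ‖x h t‖ ≤ 4 / (μ₁.re * μ₂.re) * (C ^ 2 * (A * ω t)) := by
      refine hx.trans (le_of_eq ?_)
      field_simp
      ring
    have hk' : ‖k h t‖ ≤ 2 / μ₂.re * (C ^ 2 * (A * ω t)) := by
      refine (hk t).trans ?_
      have : C * (A * ω t) ≤ C ^ 2 * (A * ω t) :=
        mul_le_mul_of_nonneg_right (by nlinarith) hω0
      calc _ = 2 / μ₂.re * (C * (A * ω t)) := by ring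
        _ ≤ _ := mul_le_mul_of_nonneg_left this (by positivity)
    have hD : 0 ≤ C ^ 2 * (A * ω t) := by positivity
    have hy : ‖μ₁ * x h t - k h t‖
        ≤ (‖μ₁‖ * (4 / (μ₁.re * μ₂.re)) + 2 / μ₂.re) * (C ^ 2 * (A * ω t)) := by
      refine (norm_sub_le _ _).trans ?_
      rw [norm_mul, add_mul, mul_assoc]
      exact add_le_add (mul_le_mul_of_nonneg_left hx' (norm_nonneg _)) hk'
    have p1 : 0 ≤ 4 / (μ₁.re * μ₂.re) * (C ^ 2 * (A * ω t)) := by positivity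
    have p2 : 0 ≤ (‖μ₁‖ * (4 / (μ₁.re * μ₂.re)) + 2 / μ₂.re) * (C ^ 2 * (A * ω t)) := by
      positivity
    constructor
    · refine (Complex.abs_re_le_norm _).trans (hx'.trans ?_)
      linarith
    · refine (Complex.abs_re_le_norm _).trans (hy.trans ?_)
      linarith

/-- Nonlinear perturbations of `ξ'' = a ξ' - b ξ`: if the forcing is dominated by a slow weight
and the perturbation has a small Lipschitz constant, there is a solution dominated by the
weight. -/
lemma exists_perturbed_solution {a b C : ℝ} (ha : 0 < a) (hb : 0 < b) (hC : 1 ≤ C) :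
    ∃ ε e M : ℝ, 0 < ε ∧ 0 < e ∧ 0 < M ∧
      ∀ (N : ℝ → ℝ → ℝ → ℝ) (ω : ℝ → ℝ) (δ : ℝ),
        (Continuous fun q : ℝ × ℝ × ℝ => N q.1 q.2.1 q.2.2) →
        SlowWeight C ε ω → (∀ t, 0 ≤ ω t) → (∀ t, M * ω t ≤ δ) →
        (∀ t, |N t 0 0| ≤ ω t) →
        (∀ t x y x' y', |x| ≤ δ → |y| ≤ δ → |x'| ≤ δ → |y'| ≤ δ →
          |N t x y - N t x' y'| ≤ e * max |x - x'| |y - y'|) →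
        ∃ ξ η : ℝ → ℝ, (∀ t, |ξ t| ≤ M * ω t) ∧ (∀ t, |η t| ≤ M * ω t) ∧
          (∀ t, HasDerivAt ξ (η t) t) ∧
          ∀ t, HasDerivAt η (a * η t - b * ξ t + N t (ξ t) (η t)) t := by
  obtain ⟨X, Y, ε, L, hε, hL, hder, hsub, hbd⟩ := exists_linear_solution ha hb
  have hM : 0 < L * C ^ 2 * 2 := by positivity
  refine ⟨ε, 1 / (L * C ^ 2 * 2), L * C ^ 2 * 2, hε, by positivity, hM, ?_⟩
  intro N ω δ hNc hω hω0 hωδ hN0 hNl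
  let S : Set (BoundedContinuousFunction ℝ ℝ) := {h | ∀ t, |h t| ≤ 2 * ω t}
  have hSbd : ∀ h ∈ S, ∀ t, |X h t| ≤ L * C ^ 2 * 2 * ω t ∧ |Y h t| ≤ L * C ^ 2 * 2 * ω t :=
    fun h hh t => hbd h ω 2 C (by norm_num) hC hω hh t
  have hbc : ∀ h : BoundedContinuousFunction ℝ ℝ, ∀ t, |h t| ≤ ‖h‖ := fun h t =>
    h.norm_coe_le_norm t
  have hXc : ∀ h : BoundedContinuousFunction ℝ ℝ, Continuous (X h) := fun h =>
    continuous_iff_continuousAt.2 fun t => (hder h _ h.continuous (hbc h) t).1.continuousAt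
  have hYc : ∀ h : BoundedContinuousFunction ℝ ℝ, Continuous (Y h) := fun h =>
    continuous_iff_continuousAt.2 fun t => (hder h _ h.continuous (hbc h) t).2.continuousAt
  have hNS : ∀ h ∈ S, ∀ t, |N t (X h t) (Y h t)| ≤ 2 * ω t := by
    intro h hh t
    obtain ⟨hx, hy⟩ := hSbd h hh t
    have hδ0 : 0 ≤ δ := (mul_nonneg hM.le (hω0 t)).trans (hωδ t)
    have h1 := hNl t (X h t) (Y h t) 0 0 (hx.trans (hωδ t)) (hy.trans (hωδ t)) (by simpa)
      (by simpa)
    rw [sub_zero, sub_zero] at h1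
    have h2 : 1 / (L * C ^ 2 * 2) * max |X h t| |Y h t| ≤ ω t := by
      refine (mul_le_mul_of_nonneg_left (max_le hx hy) (by positivity)).trans (le_of_eq ?_)
      field_simp
    have h3 := abs_sub_abs_le_abs_sub (N t (X h t) (Y h t)) (N t 0 0)
    linarith [hN0 t]
  have hM2 : ∀ t, 2 * ω t ≤ 2 * (δ / (L * C ^ 2 * 2)) := fun t => by
    have := (le_div_iff₀' hM).2 (hωδ t)
    linarith
  let Φ : S → S := fun h =>
    ⟨BoundedContinuousFunction.ofNormedAddCommGroup (fun t => N t (X h.1 t) (Y h.1 t))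
      (hNc.comp (continuous_id.prodMk ((hXc h.1).prodMk (hYc h.1))))
      (2 * (δ / (L * C ^ 2 * 2))) (fun t => (hNS h.1 h.2 t).trans (hM2 t)),
      fun t => hNS h.1 h.2 t⟩
  have hcontr : ContractingWith (1 / 2) Φ := by
    refine ⟨by norm_num [← NNReal.coe_lt_coe], LipschitzWith.of_dist_le_mul fun h₁ h₂ => ?_⟩
    rw [Subtype.dist_eq, Subtype.dist_eq]
    refine (BoundedContinuousFunction.dist_le (by positivity)).2 fun t => ?_
    obtain ⟨eX, eY⟩ := hsub h₁.1 h₂.1 _ _ h₁.1.continuous h₂.1.continuous (hbc _) (hbc _)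
    have hone : SlowWeight C ε (fun _ => (1 : ℝ)) := by
      intro t s hts
      have : (1 : ℝ) ≤ Real.exp (ε * (s - t)) :=
        Real.one_le_exp (mul_nonneg hε.le (by linarith))
      nlinarith
    obtain ⟨hx, hy⟩ := hbd (h₁.1 - h₂.1) (fun _ => 1) (dist h₁.1 h₂.1) C dist_nonneg hC hone
      (fun t => by
        rw [mul_one]
        exact BoundedContinuousFunction.dist_coe_le_dist (f := h₁.1) (g := h₂.1) t) t
    rw [eX] at hx
    rw [eY] at hy
    simp only [Pi.sub_apply, mul_one] at hx hy
    obtain ⟨hx₁, hy₁⟩ := hSbd h₁.1 h₁.2 t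
    obtain ⟨hx₂, hy₂⟩ := hSbd h₂.1 h₂.2 t
    have h1 := hNl t _ _ _ _ (hx₁.trans (hωδ t)) (hy₁.trans (hωδ t)) (hx₂.trans (hωδ t))
      (hy₂.trans (hωδ t))
    refine h1.trans ((mul_le_mul_of_nonneg_left (max_le hx hy) (by positivity)).trans
      (le_of_eq ?_))
    push_cast
    field_simp
  have hclosed : IsClosed S := by
    have : S = ⋂ t, {h : BoundedContinuousFunction ℝ ℝ | |h t| ≤ 2 * ω t} := by
      ext h; simp [S]
    rw [this]
    exact isClosed_iInter fun t => isClosed_le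
      (continuous_eval_const t).abs continuous_const
  have : CompleteSpace S := hclosed.completeSpace_coe
  have : Nonempty S := ⟨⟨0, fun t => by simpa using hω0 t⟩⟩
  obtain ⟨h, hfix⟩ : ∃ h : S, Φ h = h := ⟨_, hcontr.fixedPoint_isFixedPt⟩
  have hval : ∀ t, h.1 t = N t (X h.1 t) (Y h.1 t) := fun t => by
    conv_lhs => rw [← hfix]
    rfl
  refine ⟨X h.1, Y h.1, fun t => (hSbd h.1 h.2 t).1, fun t => (hSbd h.1 h.2 t).2,
    fun t => (hder h.1 _ h.1.continuous (hbc _) t).1, fun t => ?_⟩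
  have := (hder h.1 _ h.1.continuous (hbc _) t).2
  rwa [hval t] at this

/-- The part of the rescaled equation that is not linear in `(ξ, η)`; `x` and `y` stand for the
first two derivatives of `log g'`. -/
noncomputable def hodographResidual (p b ξ η x y : ℝ) : ℝ :=
  -((1 - η - p * x) * x) - p * y +
    b * (ξ - p * η - (1 - η - p * x) ^ 2 * (Real.exp ξ * (1 - η - p * x) ^ p - 1))

lemma hodographResidual_bounds (p b : ℝ) {e : ℝ} (he : 0 < e) :
    ∃ δ K : ℝ, 0 < δ ∧ 0 < K ∧ ∀ x y, |x| ≤ δ → |y| ≤ δ →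
      (∀ ξ η ξ' η', |ξ| ≤ δ → |η| ≤ δ → |ξ'| ≤ δ → |η'| ≤ δ →
        |hodographResidual p b ξ η x y - hodographResidual p b ξ' η' x y| ≤ e * max |ξ - ξ'| |η - η'|) ∧
      |hodographResidual p b 0 0 x y| ≤ K * max |x| |y| := by
  let E : ℝ × ℝ × ℝ × ℝ → ℝ := fun q => hodographResidual p b q.1 q.2.1 q.2.2.1 q.2.2.2
  have hP : ContDiffAt ℝ 1 (fun q : ℝ × ℝ × ℝ × ℝ => (1 - q.2.1 - p * q.2.2.1) ^ p) 0 :=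
    ContDiffAt.rpow_const_of_ne (by fun_prop) (by simp)
  have hE : ContDiffAt ℝ 1 E 0 := by
    simp only [E, hodographResidual]
    have h1 : ContDiffAt ℝ 1 (fun q : ℝ × ℝ × ℝ × ℝ => Real.exp q.1) 0 := by fun_prop
    have h2 : ContDiffAt ℝ 1 (fun q : ℝ × ℝ × ℝ × ℝ => 1 - q.2.1 - p * q.2.2.1) 0 := by fun_prop
    have h3 : ContDiffAt ℝ 1 (fun q : ℝ × ℝ × ℝ × ℝ => q.1 - p * q.2.1) 0 := by fun_prop
    have h4 : ContDiffAt ℝ 1 (fun q : ℝ × ℝ × ℝ × ℝ => q.2.2.1) 0 := by fun_prop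
    have h5 : ContDiffAt ℝ 1 (fun q : ℝ × ℝ × ℝ × ℝ => p * q.2.2.2) 0 := by fun_prop
    exact (((h2.mul h4).neg).sub h5).add
      (contDiffAt_const.mul (h3.sub ((h2.pow 2).mul ((h1.mul hP).sub contDiffAt_const))))
  have hs := hE.hasStrictFDerivAt one_ne_zero
  set D := fderiv ℝ E 0 with hD
  have hdir : ∀ v w : ℝ, D (v, w, 0, 0) = 0 := by
    intro v w
    have hline : HasDerivAt (fun τ : ℝ => τ • ((v, w, 0, 0) : ℝ × ℝ × ℝ × ℝ)) (v, w, 0, 0) 0 := by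
      simpa using (hasDerivAt_id (0 : ℝ)).smul_const ((v, w, 0, 0) : ℝ × ℝ × ℝ × ℝ)
    have h0 : HasFDerivAt E D ((0 : ℝ) • ((v, w, 0, 0) : ℝ × ℝ × ℝ × ℝ)) := by
      rw [zero_smul]; exact hs.hasFDerivAt
    have h1 := h0.comp_hasDerivAt 0 hline
    have h2 : HasDerivAt (E ∘ fun τ : ℝ => τ • ((v, w, 0, 0) : ℝ × ℝ × ℝ × ℝ)) 0 0 := by
      have hv : HasDerivAt (fun τ : ℝ => τ * v) v 0 := by
        simpa using (hasDerivAt_id (0 : ℝ)).mul_const v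
      have hw : HasDerivAt (fun τ : ℝ => τ * w) w 0 := by
        simpa using (hasDerivAt_id (0 : ℝ)).mul_const w
      have hq : HasDerivAt (fun τ : ℝ => 1 - τ * w) (-w) 0 := hw.const_sub 1
      have hr := hq.rpow_const (p := p) (Or.inl (by simp))
      have h := ((hv.sub (hw.const_mul p)).sub
        ((hq.pow 2).mul ((hv.exp.mul hr).sub_const 1))).const_mul b
      have hfun : (E ∘ fun τ : ℝ => τ • ((v, w, 0, 0) : ℝ × ℝ × ℝ × ℝ)) = fun τ : ℝ =>
          b * ((τ * v - p * (τ * w)) -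
            (1 - τ * w) ^ 2 * (Real.exp (τ * v) * (1 - τ * w) ^ p - 1)) := by
        ext τ
        simp [E, hodographResidual]
      rw [hfun]
      refine h.congr_deriv ?_
      simp
      ring_nf
      simp
    exact h1.unique h2
  have hE0 : E 0 = 0 := by simp [E, hodographResidual]
  have hev := (hasStrictFDerivAt_iff_isLittleO.1 hs).def he
  rw [nhds_prod_eq, Filter.eventually_prod_self_iff'] at hev
  obtain ⟨t, ht, htE⟩ := hev
  obtain ⟨δ, hδ, hball⟩ := Metric.nhds_basis_closedBall.mem_iff.1 ht
  have hmem : ∀ {ξ η x y : ℝ}, |ξ| ≤ δ → |η| ≤ δ → |x| ≤ δ → |y| ≤ δ → (ξ, η, x, y) ∈ t := by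
    intro ξ η x y h1 h2 h3 h4
    apply hball
    rw [mem_closedBall_zero_iff]
    simp [Prod.norm_def, h1, h2, h3, h4]
  refine ⟨δ, ‖D‖ + e, hδ, by positivity, fun x y hx hy => ⟨?_, ?_⟩⟩
  · intro ξ η ξ' η' h1 h2 h3 h4
    have := htE _ (hmem h1 h2 hx hy) _ (hmem h3 h4 hx hy)
    have hdir' : D (ξ - ξ', η - η', 0) = 0 := hdir _ _
    simpa [E, hdir', Prod.norm_def] using this
  · have h0 : |(0 : ℝ)| ≤ δ := by simpa using hδ.le
    have h1 := htE _ (hmem h0 h0 hx hy) _ (hmem h0 h0 h0 h0)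
    have h2 : E (0, 0, 0, 0) = 0 := hE0
    rw [h2] at h1
    have h3 : ‖((0, 0, x, y) : ℝ × ℝ × ℝ × ℝ)‖ = max |x| |y| := by
      simp [Prod.norm_def]
    have h4 := D.le_opNorm (0, 0, x, y)
    simp only [Prod.mk_sub_mk, sub_zero] at h1
    rw [h3] at h1 h4
    have h5 : |E (0, 0, x, y)| ≤ ‖D‖ * max |x| |y| + e * max |x| |y| := by
      have h6 := abs_sub_abs_le_abs_sub (E (0, 0, x, y)) (D (0, 0, x, y))
      rw [Real.norm_eq_abs] at h1 h4
      linarith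
    rw [add_mul]
    exact h5

lemma exists_hodograph_solution {κ p C S : ℝ} (hκ : 0 < κ) (hp : 1 ≤ p) (hC : 1 ≤ C)
    {G₁ G₂ : ℝ → ℝ} (hc₁ : ContinuousOn G₁ (Ici S)) (hc₂ : ContinuousOn G₂ (Ici S))
    (hlim : Tendsto G₁ atTop (nhds 0)) (hG₂ : G₂ =O[atTop] G₁)
    (hslow : ∀ ε > 0, ∀ᶠ t in atTop, ∀ s, t ≤ s → |G₁ s| ≤ C * |G₁ t| * Real.exp (ε * (s - t))) :
    ∃ S₀ M : ℝ, S ≤ S₀ ∧ 0 < M ∧ ∃ ξ η : ℝ → ℝ, ∀ s, S₀ ≤ s →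
      |ξ s| ≤ M * |G₁ s| ∧ |η s| ≤ M * |G₁ s| ∧ 1 / 2 ≤ 1 - η s - p * G₁ s ∧
      HasDerivAt ξ (η s) s ∧
      HasDerivAt η (-((1 - η s - p * G₁ s) * G₁ s) - p * G₂ s -
        κ / p * ((1 - η s - p * G₁ s) ^ 2 *
          (Real.exp (ξ s) * (1 - η s - p * G₁ s) ^ p - 1))) s := by
  have hp0 : 0 < p := by linarith
  obtain ⟨ε, e, M, hε, he, hM, hsol⟩ := exists_perturbed_solution hκ (div_pos hκ hp0) hC
  obtain ⟨δ, K, hδ, hK, hres⟩ := hodographResidual_bounds p (κ / p) he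
  obtain ⟨K₂, hK₂, hG₂⟩ := hG₂.exists_pos
  rw [IsBigOWith] at hG₂
  have hsmall : ∀ c > 0, ∀ᶠ s in atTop, |G₁ s| ≤ c := fun c hc => by
    have := hlim.abs
    rw [abs_zero] at this
    exact this.eventually_le_const hc
  set K₃ := K * max 1 K₂ with hK₃
  have hK₃0 : 0 < K₃ := mul_pos hK (by positivity)
  have hev := (((hsmall δ hδ).and (hsmall (δ / K₂) (by positivity))).and
    ((hsmall (δ / (M * K₃)) (by positivity)).and
      (hsmall (1 / (2 * (M * K₃ + p))) (by positivity)))).and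
    (hG₂.and ((hslow ε hε).and (eventually_ge_atTop S)))
  obtain ⟨S₀, hS₀⟩ := eventually_atTop.1 hev
  have hSS : S ≤ S₀ := (hS₀ S₀ le_rfl).2.2.2
  let m : ℝ → ℝ := fun s => max s S₀
  have hmS : ∀ s, S₀ ≤ m s := fun s => le_max_right _ _
  have hmc : Continuous m := by fun_prop
  have hg₁ : Continuous fun s => G₁ (m s) :=
    hc₁.comp_continuous hmc fun s => hSS.trans (hmS s)
  have hg₂ : Continuous fun s => G₂ (m s) :=
    hc₂.comp_continuous hmc fun s => hSS.trans (hmS s)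
  have hδ₁ : ∀ s, S₀ ≤ s → |G₁ s| ≤ δ := fun s hs => (hS₀ s hs).1.1.1
  have hG : ∀ s, S₀ ≤ s → |G₂ s| ≤ K₂ * |G₁ s| := fun s hs => (hS₀ s hs).2.1
  have hδ₂ : ∀ s, S₀ ≤ s → |G₂ s| ≤ δ := fun s hs => by
    refine (hG s hs).trans ((mul_le_mul_of_nonneg_left (hS₀ s hs).1.1.2 hK₂.le).trans (le_of_eq ?_))
    field_simp
  obtain ⟨ξ, η, hξb, hηb, hξ, hη⟩ := hsol
    (fun s x y => hodographResidual p (κ / p) x y (G₁ (m s)) (G₂ (m s))) (fun s => K₃ * |G₁ (m s)|) δ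
    (by
      have c1 : Continuous fun q : ℝ × ℝ × ℝ => G₁ (m q.1) := hg₁.comp continuous_fst
      have c2 : Continuous fun q : ℝ × ℝ × ℝ => G₂ (m q.1) := hg₂.comp continuous_fst
      have c3 : Continuous fun q : ℝ × ℝ × ℝ => 1 - q.2.2 - p * G₁ (m q.1) :=
        (continuous_const.sub (continuous_snd.comp continuous_snd)).sub (continuous_const.mul c1)
      have c4 := c3.rpow_const (p := p) fun _ => Or.inr hp0.le
      have c5 : Continuous fun q : ℝ × ℝ × ℝ => q.2.1 - p * q.2.2 := by fun_prop
      have c6 : Continuous fun q : ℝ × ℝ × ℝ => Real.exp q.2.1 := by fun_prop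
      exact ((c3.mul c1).neg.sub (continuous_const.mul c2)).add
        (continuous_const.mul (c5.sub ((c3.pow 2).mul ((c6.mul c4).sub continuous_const)))))
    (by
      intro t s hts
      have h1 := (hS₀ (m t) (hmS t)).2.2.1 (m s) (max_le_max_right _ hts)
      have h2 : m s - m t ≤ s - t := by
        simp only [m]
        rcases le_total s S₀ with h | h <;> rcases le_total t S₀ with h' | h' <;>
          simp [h, h'] <;> linarith
      calc K₃ * |G₁ (m s)| ≤ K₃ * (C * |G₁ (m t)| * Real.exp (ε * (m s - m t))) :=
            mul_le_mul_of_nonneg_left h1 hK₃0.le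
        _ ≤ K₃ * (C * |G₁ (m t)| * Real.exp (ε * (s - t))) := by
            gcongr
        _ = _ := by ring)
    (fun s => by positivity)
    (fun s => by
      have h1 := mul_le_mul_of_nonneg_left (hS₀ (m s) (hmS s)).1.2.1 (mul_pos hM hK₃0).le
      rw [mul_div_cancel₀ _ (by positivity)] at h1
      linarith)
    (fun s => by
      refine (hres _ _ (hδ₁ _ (hmS s)) (hδ₂ _ (hmS s))).2.trans ?_
      rw [hK₃, mul_assoc]
      refine mul_le_mul_of_nonneg_left (max_le ?_ ?_) hK.le
      · exact le_mul_of_one_le_left (abs_nonneg _) (le_max_left _ _)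
      · exact (hG _ (hmS s)).trans
          (mul_le_mul_of_nonneg_right (le_max_right _ _) (abs_nonneg _)))
    (fun s x y x' y' hx hy hx' hy' =>
      (hres _ _ (hδ₁ _ (hmS s)) (hδ₂ _ (hmS s))).1 x y x' y' hx hy hx' hy')
  refine ⟨S₀, M * K₃, hSS, by positivity, ξ, η, fun s hs => ?_⟩
  have hms : m s = s := max_eq_left hs
  have h1 := hξb s
  have h2 := hηb s
  have h3 := hη s
  simp only [hms] at h1 h2 h3
  rw [← mul_assoc] at h1 h2
  refine ⟨h1, h2, ?_, hξ s, h3.congr_deriv ?_⟩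
  · have h4 := mul_le_mul_of_nonneg_left (hS₀ s hs).1.2.2
      (by positivity : (0 : ℝ) ≤ M * K₃ + p)
    have h5 : (M * K₃ + p) * (1 / (2 * (M * K₃ + p))) = 1 / 2 := by field_simp
    rw [h5, add_mul] at h4
    have h6 := le_abs_self (η s)
    have h7 := mul_le_mul_of_nonneg_left (le_abs_self (G₁ s)) hp0.le
    linarith
  · unfold hodographResidual
    field_simp
    ring

lemma exists_lipschitzWith_comp_projIcc {a b : ℝ} (hab : a < b) {φ : ℝ → ℝ}
    (hφ : ContDiffOn ℝ 1 φ (Icc a b)) :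
    ∃ K B : NNReal, LipschitzWith K (fun x => φ (projIcc a b hab.le x)) ∧
      ∀ x, |φ (projIcc a b hab.le x)| ≤ B := by
  obtain ⟨K, hK⟩ := isCompact_Icc.exists_bound_of_continuousOn
    (hφ.continuousOn_derivWithin (uniqueDiffOn_Icc hab) le_rfl)
  obtain ⟨B, hB⟩ := isCompact_Icc.exists_bound_of_continuousOn hφ.continuousOn
  have hlip : LipschitzOnWith K.toNNReal φ (Icc a b) := by
    refine (convex_Icc a b).lipschitzOnWith_of_nnnorm_derivWithin_le
      (hφ.differentiableOn one_ne_zero) fun x hx => ?_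
    exact NNReal.le_toNNReal_of_coe_le (hK x hx)
  refine ⟨K.toNNReal, B.toNNReal, LipschitzWith.of_dist_le_mul fun x y => ?_, fun x => ?_⟩
  · refine (hlip.dist_le_mul _ (projIcc a b hab.le x).2 _ (projIcc a b hab.le y).2).trans ?_
    refine mul_le_mul_of_nonneg_left ?_ K.toNNReal.2
    simpa [Subtype.dist_eq] using (LipschitzWith.projIcc hab.le).dist_le_mul x y
  · exact (hB _ (projIcc a b hab.le x).2).trans (Real.le_coe_toNNReal B)

/-- Forward continuation of the radial equation, written as a first-order system for `U` and
`V = -r ^ α |U'| ^ (p - 1) U'`, until `U` becomes negative. -/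
lemma exists_radial_continuation {p α γ r₁ u₁ v₁ c : ℝ} (hp : 1 ≤ p) (hγ : 0 < γ + 1)
    (hθ : 0 < γ + 1 + p - α) (hr₁ : 0 < r₁) (hu₁ : 0 < u₁) (hv₁ : 0 < v₁) (hc : 0 < c)
    {F : ℝ → ℝ} (hF : ContDiffOn ℝ 1 F (Icc 0 u₁)) (hcF : ∀ u ∈ Icc 0 u₁, c ≤ F u) :
    ∃ R, r₁ < R ∧ ∃ U V : ℝ → ℝ, U r₁ = u₁ ∧ V r₁ = v₁ ∧ U R < 0 ∧ ∀ r ∈ Icc r₁ R,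
      v₁ ≤ V r ∧ U r ≤ u₁ ∧
      HasDerivWithinAt U (-(V r * r ^ (-α)) ^ (1 / p)) (Icc r₁ R) r ∧
      HasDerivWithinAt V (r ^ γ * F (max (U r) 0)) (Icc r₁ R) r := by
  have hp0 : 0 < p := by linarith
  set θ := γ + 1 + p - α with hθ_def
  -- a lower barrier for `V` and the resulting upper barrier for `U`
  obtain ⟨c', hc', hc'1, hc'2⟩ : ∃ c' > 0, c' * (γ + 1) ≤ c ∧ c' * r₁ ^ (γ + 1) ≤ v₁ := by
    refine ⟨min (c / (γ + 1)) (v₁ / r₁ ^ (γ + 1)), by positivity, ?_, ?_⟩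
    · exact (le_div_iff₀ hγ).1 (min_le_left _ _)
    · exact (le_div_iff₀ (by positivity)).1 (min_le_right _ _)
  set k := c' ^ (1 / p) * (p / θ) with hk_def
  have hk : 0 < k := by positivity
  obtain ⟨R, hR, hRr⟩ : ∃ R, u₁ + k * r₁ ^ (θ / p) < k * R ^ (θ / p) ∧ r₁ < R := by
    have h1 : Tendsto (fun R : ℝ => k * R ^ (θ / p)) atTop atTop :=
      (tendsto_rpow_atTop (by positivity)).const_mul_atTop hk
    exact ((h1.eventually_gt_atTop _).and (eventually_gt_atTop r₁)).exists
  have hpos : ∀ r ∈ Icc r₁ R, 0 < r := fun r hr => hr₁.trans_le hr.1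
  have hpc : ∀ q : ℝ, ContinuousOn (fun r : ℝ => r ^ q) (Icc r₁ R) := fun q =>
    continuousOn_id.rpow_const fun r hr => Or.inl (hpos r hr).ne'
  obtain ⟨B₁, hB₁⟩ := isCompact_Icc.exists_bound_of_continuousOn (hpc (-α / p))
  obtain ⟨B₂, hB₂⟩ := isCompact_Icc.exists_bound_of_continuousOn (hpc γ)
  have hB₁0 : 0 ≤ B₁ := (norm_nonneg _).trans (hB₁ r₁ ⟨le_rfl, hRr.le⟩)
  have hB₂0 : 0 ≤ B₂ := (norm_nonneg _).trans (hB₂ r₁ ⟨le_rfl, hRr.le⟩)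
  obtain ⟨K₁, D₁, hK₁, hD₁⟩ := exists_lipschitzWith_comp_projIcc hu₁ hF
  set v₂ := v₁ + B₂ * D₁ * (R - r₁) + 1 with hv₂_def
  have hRr0 : 0 ≤ R - r₁ := by linarith
  have hv₁₂ : v₁ < v₂ := by
    have : 0 ≤ B₂ * D₁ * (R - r₁) := by positivity
    linarith
  have hA : ContDiffOn ℝ 1 (fun v : ℝ => v ^ (1 / p)) (Icc v₁ v₂) :=
    contDiffOn_id.rpow_const_of_ne fun v hv => (hv₁.trans_le hv.1).ne'
  obtain ⟨K₂, D₂, hK₂, hD₂⟩ := exists_lipschitzWith_comp_projIcc hv₁₂ hA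
  let Fc : ℝ → ℝ := fun u => F (projIcc 0 u₁ hu₁.le u)
  let Ac : ℝ → ℝ := fun v => (projIcc v₁ v₂ hv₁₂.le v : ℝ) ^ (1 / p)
  let Φ : ℝ → ℝ × ℝ → ℝ × ℝ := fun r y => (-(r ^ (-α / p) * Ac y.2), r ^ γ * Fc y.1)
  have hPL : IsPicardLindelof Φ (⟨r₁, le_rfl, hRr.le⟩ : Icc r₁ R) (u₁, v₁)
      (((B₁ * D₂ + B₂ * D₁) * (R - r₁)).toNNReal) 0 (B₁ * D₂ + B₂ * D₁).toNNReal
      (B₁ * K₂ + B₂ * K₁).toNNReal := by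
    refine ⟨fun r hr => LipschitzWith.lipschitzOnWith (LipschitzWith.of_dist_le_mul
      fun y y' => ?_), fun y _ => ?_, fun r hr y _ => ?_, ?_⟩
    · rw [Real.coe_toNNReal _ (by positivity), Prod.dist_eq]
      refine max_le ?_ ?_
      · have h1 : dist (-(r ^ (-α / p) * Ac y.2)) (-(r ^ (-α / p) * Ac y'.2))
            = |r ^ (-α / p)| * dist (Ac y.2) (Ac y'.2) := by
          rw [dist_neg_neg, Real.dist_eq, Real.dist_eq, ← mul_sub, abs_mul]
        have h2 := hK₂.dist_le_mul y.2 y'.2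
        have h3 : dist y.2 y'.2 ≤ dist y y' := le_max_right _ _
        change dist (-(r ^ (-α / p) * Ac y.2)) (-(r ^ (-α / p) * Ac y'.2)) ≤ _
        rw [h1]
        calc _ ≤ B₁ * (K₂ * dist y y') := mul_le_mul (hB₁ r hr)
              (h2.trans (mul_le_mul_of_nonneg_left h3 K₂.2)) dist_nonneg hB₁0
          _ ≤ _ := by
            have : 0 ≤ B₂ * K₁ * dist y y' := by positivity
            linarith
      · have h1 : dist (r ^ γ * Fc y.1) (r ^ γ * Fc y'.1)
            = |r ^ γ| * dist (Fc y.1) (Fc y'.1) := by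
          rw [Real.dist_eq, Real.dist_eq, ← mul_sub, abs_mul]
        have h2 := hK₁.dist_le_mul y.1 y'.1
        have h3 : dist y.1 y'.1 ≤ dist y y' := le_max_left _ _
        change dist (r ^ γ * Fc y.1) (r ^ γ * Fc y'.1) ≤ _
        rw [h1]
        calc _ ≤ B₂ * (K₁ * dist y y') := mul_le_mul (hB₂ r hr)
              (h2.trans (mul_le_mul_of_nonneg_left h3 K₁.2)) dist_nonneg hB₂0
          _ ≤ _ := by
            have : 0 ≤ B₁ * K₂ * dist y y' := by positivity
            linarith
    · exact ((hpc _).mul continuousOn_const).neg.prodMk ((hpc _).mul continuousOn_const)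
    · rw [Real.coe_toNNReal _ (by positivity), Prod.norm_def]
      have q1 : 0 ≤ B₁ * D₂ := by positivity
      have q2 : 0 ≤ B₂ * D₁ := by positivity
      refine max_le ?_ ?_
      · change ‖-(r ^ (-α / p) * Ac y.2)‖ ≤ _
        rw [norm_neg, norm_mul]
        have := mul_le_mul (hB₁ r hr) (hD₂ y.2) (abs_nonneg _) hB₁0
        exact this.trans (by linarith)
      · change ‖r ^ γ * Fc y.1‖ ≤ _
        rw [norm_mul]
        have := mul_le_mul (hB₂ r hr) (hD₁ y.1) (abs_nonneg _) hB₂0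
        exact this.trans (by linarith)
    · simp only [sub_self]
      rw [max_eq_left hRr0, Real.coe_toNNReal _ (by positivity),
        Real.coe_toNNReal _ (by positivity)]
      simp
  obtain ⟨y, hy0, hy⟩ := hPL.exists_eq_forall_mem_Icc_hasDerivWithinAt₀
  have hU : ∀ r ∈ Icc r₁ R, HasDerivWithinAt (fun r => (y r).1) (-(r ^ (-α / p) * Ac (y r).2))
      (Icc r₁ R) r := fun r hr =>
    (hasFDerivAt_fst (p := y r)).comp_hasDerivWithinAt r (hy r hr)
  have hV : ∀ r ∈ Icc r₁ R, HasDerivWithinAt (fun r => (y r).2) (r ^ γ * Fc (y r).1)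
      (Icc r₁ R) r := fun r hr =>
    (hasFDerivAt_snd (p := y r)).comp_hasDerivWithinAt r (hy r hr)
  have hUc : ContinuousOn (fun r => (y r).1) (Icc r₁ R) := fun r hr => (hU r hr).continuousWithinAt
  have hVc : ContinuousOn (fun r => (y r).2) (Icc r₁ R) := fun r hr => (hV r hr).continuousWithinAt
  have hint : interior (Icc r₁ R) ⊆ Icc r₁ R := interior_subset
  have hr₁mem : r₁ ∈ Icc r₁ R := ⟨le_rfl, hRr.le⟩
  have hRmem : R ∈ Icc r₁ R := ⟨hRr.le, le_rfl⟩
  have hy1 : (y r₁).1 = u₁ := congrArg Prod.fst hy0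
  have hy2 : (y r₁).2 = v₁ := congrArg Prod.snd hy0
  have hFc : ∀ u, c ≤ Fc u := fun u => hcF _ (projIcc 0 u₁ hu₁.le u).2
  have hAc0 : ∀ v, 0 ≤ Ac v := fun v =>
    Real.rpow_nonneg (hv₁.le.trans (projIcc v₁ v₂ hv₁₂.le v).2.1) _
  have hUle : ∀ r ∈ Icc r₁ R, (y r).1 ≤ u₁ := by
    intro r hr
    have := antitoneOn_of_hasDerivWithinAt_nonpos (convex_Icc r₁ R) hUc
      (fun r hr => (hU r (hint hr)).mono hint) (fun r hr => by
        have := mul_nonneg (Real.rpow_nonneg (hpos r (hint hr)).le (-α / p)) (hAc0 (y r).2)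
        linarith) hr₁mem hr hr.1
    simpa [hy1] using this
  have hVge : ∀ r ∈ Icc r₁ R, v₁ ≤ (y r).2 := by
    intro r hr
    have := monotoneOn_of_hasDerivWithinAt_nonneg (convex_Icc r₁ R) hVc
      (fun r hr => (hV r (hint hr)).mono hint) (fun r hr =>
        mul_nonneg (Real.rpow_nonneg (hpos r (hint hr)).le γ) (hc.le.trans (hFc _)))
      hr₁mem hr hr.1
    simpa [hy2] using this
  have hVle : ∀ r ∈ Icc r₁ R, (y r).2 ≤ v₂ := by
    intro r hr
    have := antitoneOn_of_hasDerivWithinAt_nonpos (convex_Icc r₁ R)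
      (f := fun r => (y r).2 - B₂ * D₁ * r) (f' := fun r => r ^ γ * Fc (y r).1 - B₂ * D₁ * 1)
      (hVc.sub (by fun_prop))
      (fun r hr => ((hV r (hint hr)).mono hint).sub ((hasDerivWithinAt_id r _).const_mul _))
      (fun r hr => by
        have h1 := mul_le_mul (hB₂ r (hint hr)) (hD₁ (y r).1) (abs_nonneg _) hB₂0
        rw [Real.norm_eq_abs, ← abs_mul] at h1
        have h2 := le_abs_self (r ^ γ * Fc (y r).1)
        change |r ^ γ * Fc (y r).1| ≤ _ at h1
        linarith)
      hr₁mem hr hr.1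
    simp only [hy2] at this
    have h3 : B₂ * D₁ * r ≤ B₂ * D₁ * R := mul_le_mul_of_nonneg_left hr.2 (by positivity)
    rw [hv₂_def]
    linarith
  have hAc : ∀ r ∈ Icc r₁ R, Ac (y r).2 = (y r).2 ^ (1 / p) := by
    intro r hr
    simp only [Ac]
    rw [projIcc_of_mem hv₁₂.le ⟨hVge r hr, hVle r hr⟩]
  have hFc' : ∀ r ∈ Icc r₁ R, Fc (y r).1 = F (max (y r).1 0) := by
    intro r hr
    simp only [Fc]
    rw [coe_projIcc, min_eq_right (hUle r hr), max_comm]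
  have hVlow : ∀ r ∈ Icc r₁ R, c' * r ^ (γ + 1) ≤ (y r).2 := by
    intro r hr
    have := monotoneOn_of_hasDerivWithinAt_nonneg (convex_Icc r₁ R)
      (f := fun r => (y r).2 - c' * r ^ (γ + 1))
      (f' := fun r => r ^ γ * Fc (y r).1 - c' * ((γ + 1) * r ^ (γ + 1 - 1)))
      (hVc.sub (continuousOn_const.mul (hpc _)))
      (fun r hr => ((hV r (hint hr)).mono hint).sub
        (((Real.hasDerivAt_rpow_const (Or.inl (hpos r (hint hr)).ne')).const_mul
          c').hasDerivWithinAt))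
      (fun r hr => by
        have h1 : 0 ≤ r ^ γ := Real.rpow_nonneg (hpos r (hint hr)).le γ
        have h2 : r ^ γ * (c' * (γ + 1)) ≤ r ^ γ * Fc (y r).1 :=
          mul_le_mul_of_nonneg_left (hc'1.trans (hFc _)) h1
        rw [add_sub_cancel_right]
        linarith)
      hr₁mem hr hr.1
    simp only [hy2] at this
    linarith
  have hUR : (y R).1 < 0 := by
    have := antitoneOn_of_hasDerivWithinAt_nonpos (convex_Icc r₁ R)
      (f := fun r => (y r).1 + k * r ^ (θ / p))
      (f' := fun r => -(r ^ (-α / p) * Ac (y r).2) + k * ((θ / p) * r ^ (θ / p - 1)))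
      (hUc.add (continuousOn_const.mul (hpc _)))
      (fun r hr => ((hU r (hint hr)).mono hint).add
        (((Real.hasDerivAt_rpow_const (Or.inl (hpos r (hint hr)).ne')).const_mul
          k).hasDerivWithinAt))
      (fun r hr => by
        have hr0 := hpos r (hint hr)
        have h1 : (c' * r ^ (γ + 1)) ^ (1 / p) ≤ Ac (y r).2 := by
          rw [hAc r (hint hr)]
          exact Real.rpow_le_rpow (by positivity) (hVlow r (hint hr)) (by positivity)
        rw [Real.mul_rpow hc'.le (by positivity), ← Real.rpow_mul hr0.le] at h1
        have h2 := mul_le_mul_of_nonneg_left h1 (Real.rpow_nonneg hr0.le (-α / p))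
        have h3 : r ^ (θ / p - 1) = r ^ (-α / p) * r ^ ((γ + 1) * (1 / p)) := by
          rw [← Real.rpow_add hr0]
          congr 1
          rw [hθ_def]
          field_simp
          ring
        have h4 : k * (θ / p) = c' ^ (1 / p) := by
          rw [hk_def]
          field_simp
        have h5 : k * (θ / p * r ^ (θ / p - 1))
            = r ^ (-α / p) * (c' ^ (1 / p) * r ^ ((γ + 1) * (1 / p))) := by
          rw [← mul_assoc, h4, h3]
          ring
        rw [h5]
        linarith)
      hr₁mem hRmem hRr.le
    simp only [hy1] at this
    linarith
  refine ⟨R, hRr, fun r => (y r).1, fun r => (y r).2, hy1, hy2, hUR, fun r hr =>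
    ⟨hVge r hr, hUle r hr, ?_, ?_⟩⟩
  · refine (hU r hr).congr_deriv ?_
    have hr0 := hpos r hr
    rw [hAc r hr, Real.mul_rpow (hv₁.le.trans (hVge r hr)) (by positivity),
      ← Real.rpow_mul hr0.le, mul_one_div, mul_comm]
  · rw [← hFc' r hr]
    exact hV r hr

lemma inverse_facts {f g : ℝ → ℝ} (hf : ContDiffOn ℝ 4 f (Ici 0))
    (hf' : ∀ u ∈ Ici (0 : ℝ), 0 < deriv f u) (hftop : Tendsto f atTop atTop)
    (hgf : ∀ u ∈ Ici (0 : ℝ), g (f u) = u) :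
    ContDiffOn ℝ 4 g (Ioi (f 0)) ∧
      ∀ t ∈ Ioi (f 0), 0 < g t ∧ f (g t) = t ∧ 0 < deriv g t := by
  have hsurj : ∀ t ∈ Ioi (f 0), ∃ u, 0 < u ∧ f u = t := by
    intro t ht
    obtain ⟨b, hb0, hb⟩ := ((eventually_ge_atTop (0 : ℝ)).and
      (hftop.eventually_ge_atTop t)).exists
    obtain ⟨u, hu, rfl⟩ := intermediate_value_Icc hb0
      (hf.continuousOn.mono Icc_subset_Ici_self) ⟨le_of_lt ht, hb⟩
    refine ⟨u, lt_of_le_of_ne hu.1 ?_, rfl⟩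
    rintro rfl
    exact lt_irrefl _ (mem_Ioi.1 ht)
  have hleft : ∀ u : ℝ, 0 < u → ∀ᶠ x in nhds u, g (f x) = x := fun u hu => by
    filter_upwards [lt_mem_nhds hu] with x hx using hgf x hx.le
  have hfat : ∀ u : ℝ, 0 < u → ContDiffAt ℝ 4 f u := fun u hu =>
    hf.contDiffAt (Ici_mem_nhds hu)
  refine ⟨?_, ?_⟩
  · intro t ht
    obtain ⟨u, hu, rfl⟩ := hsurj t ht
    have hne : deriv f u ≠ 0 := (hf' u hu.le).ne'
    have hstrict : HasStrictDerivAt f (deriv f u) u :=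
      (hfat u hu).hasStrictDerivAt (by norm_num)
    have hfd := hstrict.hasStrictFDerivAt_equiv hne
    have hloc := (hfat u hu).to_localInverse hfd.hasFDerivAt (by norm_num)
    refine (hloc.congr_of_eventuallyEq ?_).contDiffWithinAt
    exact hfd.localInverse_unique (hleft u hu)
  · intro t ht
    obtain ⟨u, hu, rfl⟩ := hsurj t ht
    have hstrict : HasStrictDerivAt f (deriv f u) u :=
      (hfat u hu).hasStrictDerivAt (by norm_num)
    have h := hstrict.to_local_left_inverse (hf' u hu.le).ne' (hleft u hu)
    rw [hgf u hu.le, h.hasDerivAt.deriv]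
    exact ⟨hu, rfl, inv_pos.2 (hf' u hu.le)⟩

lemma hasDerivAt_iterated_deriv {g : ℝ → ℝ} {a : ℝ} (hg : ContDiffOn ℝ 4 g (Ioi a)) :
    (∀ t ∈ Ioi a, HasDerivAt g (deriv g t) t ∧ HasDerivAt (deriv g) (deriv (deriv g) t) t ∧
      HasDerivAt (deriv (deriv g)) (deriv (deriv (deriv g)) t) t) ∧
      ContinuousOn (deriv (deriv (deriv g))) (Ioi a) := by
  have h1 : ContDiffOn ℝ 3 (deriv g) (Ioi a) := hg.deriv_of_isOpen isOpen_Ioi (by norm_num)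
  have h2 : ContDiffOn ℝ 2 (deriv (deriv g)) (Ioi a) :=
    h1.deriv_of_isOpen isOpen_Ioi (by norm_num)
  have h3 : ContDiffOn ℝ 1 (deriv (deriv (deriv g))) (Ioi a) :=
    h2.deriv_of_isOpen isOpen_Ioi (by norm_num)
  refine ⟨fun t ht => ⟨?_, ?_, ?_⟩, h3.continuousOn⟩
  · exact ((hg.differentiableOn (by norm_num)).differentiableAt (Ioi_mem_nhds ht)).hasDerivAt
  · exact ((h1.differentiableOn (by norm_num)).differentiableAt (Ioi_mem_nhds ht)).hasDerivAt
  · exact ((h2.differentiableOn (by norm_num)).differentiableAt (Ioi_mem_nhds ht)).hasDerivAt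

lemma exists_uniform_bound_of_isLittleO {k : ℝ → ℝ}
    (hk : ∀ h : ℝ → ℝ, (h =o[atTop] fun t : ℝ => t) →
      (fun t => k (t + h t)) =O[atTop] k) :
    ∃ δ C t₀ : ℝ, 0 < δ ∧ 0 < C ∧ ∀ t, t₀ ≤ t → ∀ s, |s - t| ≤ δ * t → |k s| ≤ C * |k t| := by
  by_contra! hcon
  have hbad : ∀ n : ℕ, ∃ t, (n + 1 : ℝ) ≤ t ∧ ∃ s, |s - t| ≤ 1 / (n + 1 : ℝ) * t ∧
      (n + 1 : ℝ) * |k t| < |k s| := fun n =>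
    hcon (1 / (n + 1)) (n + 1) (n + 1) (by positivity) (by positivity)
  choose T hT S hS hk' using hbad
  classical
  set h : ℝ → ℝ := fun t => if ht : ∃ n, T n = t then S ht.choose - t else 0 with hdef
  have hh : h =o[atTop] fun t : ℝ => t := by
    rw [isLittleO_iff]
    intro c hc
    obtain ⟨K, hK⟩ := exists_nat_one_div_lt hc
    have hfin : ∀ᶠ t : ℝ in atTop, ∀ n ∈ Finset.range K, T n < t :=
      (Finset.eventually_all _).2 fun n _ => eventually_gt_atTop (T n)
    filter_upwards [hfin, eventually_gt_atTop 0] with t ht ht0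
    by_cases hex : ∃ n, T n = t
    · have hsp := hex.choose_spec
      have hge : K ≤ hex.choose := by
        by_contra! hlt
        exact (ht _ (Finset.mem_range.2 hlt)).ne hsp
      have hb := hS hex.choose
      rw [hsp] at hb
      simp only [hdef, dif_pos hex, Real.norm_eq_abs, abs_of_pos ht0]
      refine hb.trans (mul_le_mul_of_nonneg_right ?_ ht0.le)
      refine le_trans ?_ hK.le
      exact one_div_le_one_div_of_le (by positivity) (by exact_mod_cast Nat.succ_le_succ hge)
    · simp only [hdef, dif_neg hex, norm_zero]
      positivity
  obtain ⟨C, hC⟩ := (hk h hh).bound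
  obtain ⟨K, hK⟩ := exists_nat_ge C
  have hTtop : Tendsto T atTop atTop :=
    tendsto_atTop_mono (fun n => (le_add_of_nonneg_right zero_le_one).trans (hT n))
      tendsto_natCast_atTop_atTop
  have hfin : ∀ᶠ t : ℝ in atTop, ∀ n ∈ Finset.range K, T n < t :=
    (Finset.eventually_all _).2 fun n _ => eventually_gt_atTop (T n)
  obtain ⟨n, hn, hnC⟩ := (hTtop.eventually (hfin.and hC)).exists
  have hex : ∃ m, T m = T n := ⟨n, rfl⟩
  have hsp := hex.choose_spec
  have hge : K ≤ hex.choose := by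
    by_contra! hlt
    exact (hn _ (Finset.mem_range.2 hlt)).ne hsp
  have hb := hk' hex.choose
  rw [hsp] at hb
  simp only [hdef, dif_pos hex, add_sub_cancel, Real.norm_eq_abs] at hnC
  have hKm : (K : ℝ) ≤ hex.choose := by exact_mod_cast hge
  nlinarith [abs_nonneg (k (T n))]

lemma isBigO_of_tendsto_div_one {k l : ℝ → ℝ} (h : Tendsto (fun t => k t / l t) atTop (nhds 1)) :
    l =O[atTop] k := by
  refine IsBigO.of_bound 2 ?_
  filter_upwards [h.eventually (lt_mem_nhds (show (1 / 2 : ℝ) < 1 by norm_num))] with t ht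
  have hne : l t ≠ 0 := by
    intro h0
    rw [h0, div_zero] at ht
    linarith
  have h2 : 1 / 2 < |k t| / |l t| := by
    rw [← abs_div]
    exact ht.trans_le (le_abs_self _)
  have := (lt_div_iff₀ (abs_pos.2 hne)).1 h2
  rw [Real.norm_eq_abs, Real.norm_eq_abs]
  linarith

lemma hasDerivAt_log_deriv {g : ℝ → ℝ} {a t : ℝ} (hg : ContDiffOn ℝ 4 g (Ioi a))
    (hpos : ∀ t ∈ Ioi a, 0 < deriv g t) (ht : t ∈ Ioi a) :
    HasDerivAt (fun t => Real.log (deriv g t)) (deriv (deriv g) t / deriv g t) t ∧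
      HasDerivAt (fun t => deriv (deriv g) t / deriv g t)
        (deriv (deriv (deriv g)) t / deriv g t - (deriv (deriv g) t / deriv g t) ^ 2) t := by
  obtain ⟨-, h1, h2⟩ := (hasDerivAt_iterated_deriv hg).1 t ht
  have hne := (hpos t ht).ne'
  refine ⟨h1.log hne, (h2.div h1 hne).congr_deriv ?_⟩
  field_simp

lemma tendsto_log_deriv_zero {g : ℝ → ℝ} (hpos : ∀ᶠ t in atTop, 0 < deriv g t)
    (hA2a : Tendsto (fun t => deriv (deriv g) t) atTop (nhds 0))
    (hA4 : Tendsto (fun t => deriv (deriv g) t / deriv g t * Real.log (deriv g t))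
      atTop (nhds 0)) :
    Tendsto (fun t => deriv (deriv g) t / deriv g t) atTop (nhds 0) := by
  have hb : Tendsto (fun t => |deriv (deriv g) t / deriv g t * Real.log (deriv g t)| +
      Real.exp 1 * |deriv (deriv g) t|) atTop (nhds 0) := by
    simpa using hA4.abs.add (hA2a.abs.const_mul (Real.exp 1))
  refine squeeze_zero_norm' ?_ hb
  filter_upwards [hpos] with t ht
  rw [Real.norm_eq_abs]
  rcases le_or_gt 1 |Real.log (deriv g t)| with h | h
  · rw [abs_mul]
    have := mul_le_mul_of_nonneg_left h (abs_nonneg (deriv (deriv g) t / deriv g t))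
    have : 0 ≤ Real.exp 1 * |deriv (deriv g) t| := by positivity
    linarith
  · have h1 : Real.exp (-1) ≤ deriv g t := by
      rw [← Real.le_log_iff_exp_le ht]
      exact (abs_lt.1 h).1.le
    have h2 : |deriv (deriv g) t / deriv g t| ≤ Real.exp 1 * |deriv (deriv g) t| := by
      rw [abs_div, abs_of_pos ht, div_le_iff₀ ht]
      have : 1 ≤ Real.exp 1 * deriv g t := by
        calc (1 : ℝ) = Real.exp 1 * Real.exp (-1) := by rw [← Real.exp_add]; simp
          _ ≤ _ := by gcongr
      nlinarith [abs_nonneg (deriv (deriv g) t)]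
    have := abs_nonneg (deriv (deriv g) t / deriv g t * Real.log (deriv g t))
    linarith

lemma abs_sub_le_of_hasDerivAt_of_tendsto_zero {G G₁ : ℝ → ℝ}
    (hG : ∀ᶠ t in atTop, HasDerivAt G (G₁ t) t) (h0 : Tendsto G₁ atTop (nhds 0))
    {ε : ℝ} (hε : 0 < ε) :
    ∀ᶠ t in atTop, ∀ s, t ≤ s → |G s - G t| ≤ ε * (s - t) := by
  have h1 : ∀ᶠ t in atTop, |G₁ t| ≤ ε := by
    filter_upwards [h0.eventually (Metric.ball_mem_nhds 0 hε)] with t ht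
    simpa using (Metric.mem_ball.1 ht).le
  filter_upwards [eventually_forall_ge_atTop.2 (hG.and h1)] with t ht s hs
  have := (convex_Icc t s).norm_image_sub_le_of_norm_hasDerivWithin_le
    (f := G) (f' := G₁) (C := ε) (fun x hx => (ht x hx.1).1.hasDerivWithinAt)
    (fun x hx => (ht x hx.1).2) (left_mem_Icc.2 hs) (right_mem_Icc.2 hs)
  simpa [Real.norm_eq_abs, abs_of_nonneg (sub_nonneg.2 hs)] using this

lemma isLittleO_id_of_hasDerivAt_of_tendsto_zero {G G₁ : ℝ → ℝ}
    (hG : ∀ᶠ t in atTop, HasDerivAt G (G₁ t) t) (h0 : Tendsto G₁ atTop (nhds 0)) :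
    G =o[atTop] fun t : ℝ => t := by
  rw [isLittleO_iff]
  intro c hc
  obtain ⟨T, hT, hT0⟩ := ((abs_sub_le_of_hasDerivAt_of_tendsto_zero hG h0
    (half_pos hc)).and (eventually_ge_atTop 0)).exists
  filter_upwards [eventually_ge_atTop T, eventually_ge_atTop (2 * |G T| / c)] with t ht ht2
  have h1 := hT t ht
  rw [div_le_iff₀ hc] at ht2
  rw [Real.norm_eq_abs, Real.norm_eq_abs, abs_of_nonneg (hT0.trans ht)]
  have h2 : |G t| ≤ |G t - G T| + |G T| := by simpa using abs_add_le (G t - G T) (G T)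
  nlinarith

lemma isBigO_log_deriv_second {g : ℝ → ℝ}
    (h0 : Tendsto (fun t => deriv (deriv g) t / deriv g t) atTop (nhds 0))
    (h3 : deriv (deriv (deriv g)) =O[atTop] deriv (deriv g)) :
    (fun t => deriv (deriv (deriv g)) t / deriv g t - (deriv (deriv g) t / deriv g t) ^ 2)
      =O[atTop] fun t => deriv (deriv g) t / deriv g t := by
  refine IsBigO.sub ?_ ?_
  · simpa only [div_eq_mul_inv] using h3.mul (isBigO_refl (fun t => (deriv g t)⁻¹) atTop)
  · simpa only [pow_two, one_mul] using
      (h0.isBigO_one ℝ).mul (isBigO_refl (fun t => deriv (deriv g) t / deriv g t) atTop)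

lemma exists_slow_bound_log_deriv {g : ℝ → ℝ} {a : ℝ} (hg : ContDiffOn ℝ 4 g (Ioi a))
    (hpos : ∀ t ∈ Ioi a, 0 < deriv g t)
    (h0 : Tendsto (fun t => deriv (deriv g) t / deriv g t) atTop (nhds 0))
    (hA5c : ∃ C : ℝ, ∀ᶠ t in atTop, ∀ s, t ≤ s →
      |deriv (deriv g) s| ≤ C * |deriv (deriv g) t|) :
    ∃ C : ℝ, 1 ≤ C ∧ ∀ ε > 0, ∀ᶠ t in atTop, ∀ s, t ≤ s →
      |deriv (deriv g) s / deriv g s| ≤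
        C * |deriv (deriv g) t / deriv g t| * Real.exp (ε * (s - t)) := by
  obtain ⟨C, hC⟩ := hA5c
  refine ⟨max C 1, le_max_right _ _, fun ε hε => ?_⟩
  have hG : ∀ᶠ t in atTop, HasDerivAt (fun t => Real.log (deriv g t))
      (deriv (deriv g) t / deriv g t) t := by
    filter_upwards [eventually_gt_atTop a] with t ht
    exact (hasDerivAt_log_deriv hg hpos ht).1
  filter_upwards [hC, abs_sub_le_of_hasDerivAt_of_tendsto_zero hG h0 hε, eventually_gt_atTop a]
    with t h1 h2 ht s hs
  have hps := hpos s (lt_of_lt_of_le ht hs)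
  have hpt := hpos t ht
  have h3 : deriv g t ≤ deriv g s * Real.exp (ε * (s - t)) := by
    rw [← Real.log_le_log_iff hpt (by positivity), Real.log_mul hps.ne' (Real.exp_ne_zero _),
      Real.log_exp]
    linarith [(abs_le.1 (h2 s hs)).1]
  have h4 : |deriv (deriv g) s| ≤ max C 1 * |deriv (deriv g) t| :=
    (h1 s hs).trans (by gcongr; exact le_max_left _ _)
  rw [abs_div, abs_div, abs_of_pos hps, abs_of_pos hpt, div_le_iff₀ hps]
  calc |deriv (deriv g) s| ≤ max C 1 * |deriv (deriv g) t| := h4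
    _ = max C 1 * |deriv (deriv g) t| / deriv g t * deriv g t := by field_simp
    _ ≤ max C 1 * |deriv (deriv g) t| / deriv g t * (deriv g s * Real.exp (ε * (s - t))) := by
        gcongr
    _ = _ := by ring

lemma exists_inverse_of_deriv_ge {t P : ℝ → ℝ} {S : ℝ}
    (ht : ∀ s, S ≤ s → HasDerivAt t (P s) s) (hP : ∀ s, S ≤ s → 1 / 2 ≤ P s)
    (hc : ∀ s, S ≤ s → ContinuousAt P s) :
    ∃ X : ℝ → ℝ, Tendsto X atTop atTop ∧
      ∀ y, t S < y → S < X y ∧ t (X y) = y ∧ HasDerivAt X (P (X y))⁻¹ y := by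
  have hcont : ContinuousOn t (Ici S) := fun s hs => (ht s hs).continuousAt.continuousWithinAt
  have hmono : StrictMonoOn t (Ici S) := by
    refine strictMonoOn_of_deriv_pos (convex_Ici S) hcont fun s hs => ?_
    rw [interior_Ici] at hs
    rw [(ht s hs.le).deriv]
    linarith [hP s hs.le]
  have hgrow : ∀ s, S ≤ s → (s - S) / 2 ≤ t s - t S := by
    intro s hs
    have := (convex_Ici S).mul_sub_le_image_sub_of_le_deriv hcont
      (fun x hx => ((ht x (interior_subset hx)).differentiableAt).differentiableWithinAt)
      (C := 1 / 2) (fun x hx => by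
        rw [(ht x (interior_subset hx)).deriv]
        exact hP x (interior_subset hx)) S self_mem_Ici s hs hs
    linarith
  have hsurj : ∀ y, t S < y → ∃ s, S < s ∧ t s = y := by
    intro y hy
    have hb : S ≤ S + 2 * (y - t S) := by linarith
    obtain ⟨s, hs, rfl⟩ := intermediate_value_Icc hb (hcont.mono Icc_subset_Ici_self)
      ⟨hy.le, by have := hgrow _ hb; linarith⟩
    refine ⟨s, lt_of_le_of_ne hs.1 ?_, rfl⟩
    rintro rfl
    exact lt_irrefl _ hy
  choose! X hX using hsurj
  have hinv : ∀ s, S < s → X (t s) = s := fun s hs => by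
    have hlt : t S < t s := hmono self_mem_Ici hs.le hs
    exact hmono.injOn (hX _ hlt).1.le hs.le (hX _ hlt).2
  refine ⟨X, ?_, fun y hy => ?_⟩
  · refine tendsto_atTop.2 fun b => ?_
    filter_upwards [eventually_gt_atTop (t S), eventually_gt_atTop (t (max b S))] with y hy hyb
    refine (le_max_left b S).trans (le_of_lt ?_)
    rw [← hmono.lt_iff_lt (le_max_right b S) (hX y hy).1.le, (hX y hy).2]
    exact hyb
  · obtain ⟨h1, h2⟩ := hX y hy
    refine ⟨h1, h2, ?_⟩
    have hstrict : HasStrictDerivAt t (P (X y)) (X y) :=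
      hasStrictDerivAt_of_hasDerivAt_of_continuousAt
        (by filter_upwards [lt_mem_nhds h1] with s hs using ht s hs.le) (hc _ h1.le)
    have hne : P (X y) ≠ 0 := (half_pos one_pos |>.trans_le (hP _ h1.le)).ne'
    have := hstrict.to_local_left_inverse hne
      (by filter_upwards [lt_mem_nhds h1] with s hs using hinv s hs)
    rw [h2] at this
    exact this.hasDerivAt

lemma exists_singular_profile {κ p a : ℝ} (hκ : 0 < κ) (hp : 1 ≤ p) {g : ℝ → ℝ}
    (hg : ContDiffOn ℝ 4 g (Ioi a)) (hpos : ∀ t ∈ Ioi a, 0 < deriv g t)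
    (h0 : Tendsto (fun t => deriv (deriv g) t / deriv g t) atTop (nhds 0))
    (h3 : deriv (deriv (deriv g)) =O[atTop] deriv (deriv g))
    (hA5c : ∃ C : ℝ, ∀ᶠ t in atTop, ∀ s, t ≤ s →
      |deriv (deriv g) s| ≤ C * |deriv (deriv g) t|) :
    ∃ M y₀ : ℝ, 0 < M ∧ ∃ X Q : ℝ → ℝ, Tendsto X atTop atTop ∧ ∀ y, y₀ < y →
      a < X y ∧ 0 < Q y ∧
      |X y - p * Real.log (deriv g (X y)) - y| ≤ M * |deriv (deriv g) (X y) / deriv g (X y)| ∧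
      HasDerivAt (fun y => g (X y)) (Q y) y ∧
      HasDerivAt (fun y => Q y ^ p) (κ * (Q y ^ p - Real.exp (X y - y))) y := by
  obtain ⟨C, hC, hslow⟩ := exists_slow_bound_log_deriv hg hpos h0 hA5c
  have hD := fun t ht => hasDerivAt_log_deriv hg hpos (t := t) ht
  have hI := hasDerivAt_iterated_deriv hg
  have haS : Ici (a + 1) ⊆ Ioi a := fun x hx => by
    have := mem_Ici.1 hx
    exact mem_Ioi.2 (by linarith)
  have hc₁ : ContinuousOn (fun t => deriv (deriv g) t / deriv g t) (Ici (a + 1)) :=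
    fun t ht => (hD t (haS ht)).2.continuousAt.continuousWithinAt
  have hc₂ : ContinuousOn (fun t => deriv (deriv (deriv g)) t / deriv g t -
      (deriv (deriv g) t / deriv g t) ^ 2) (Ici (a + 1)) := by
    refine ContinuousOn.sub (ContinuousOn.div (hI.2.mono haS) ?_ ?_) (hc₁.pow 2)
    · exact fun t ht => (hI.1 t (haS ht)).2.1.continuousAt.continuousWithinAt
    · exact fun t ht => (hpos t (haS ht)).ne'
  obtain ⟨S₀, M, hS₀, hM, ξ, η, H⟩ := exists_hodograph_solution hκ hp hC hc₁ hc₂ h0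
    (isBigO_log_deriv_second h0 h3) hslow
  have hp0 : 0 < p := by linarith
  set G₁ : ℝ → ℝ := fun t => deriv (deriv g) t / deriv g t with hG₁
  set P : ℝ → ℝ := fun s => 1 - η s - p * G₁ s with hPdef
  have hSa : ∀ s, S₀ ≤ s → a < s := fun s hs => by linarith
  have hPder : ∀ s, S₀ ≤ s → HasDerivAt P (P s * G₁ s + κ / p * (P s ^ 2 *
      (Real.exp (ξ s) * P s ^ p - 1))) s := by
    intro s hs
    obtain ⟨-, -, -, -, h5⟩ := H s hs
    refine (((hasDerivAt_const s (1 : ℝ)).sub h5).sub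
      (((hD s (hSa s hs)).2).const_mul p)).congr_deriv ?_
    simp only [hPdef, hG₁]
    ring
  obtain ⟨X, hXtop, hX⟩ := exists_inverse_of_deriv_ge (S := S₀) (P := P)
    (t := fun s => s - p * Real.log (deriv g s) - ξ s)
    (fun s hs => by
      obtain ⟨-, -, -, h4, -⟩ := H s hs
      refine (((hasDerivAt_id s).sub ((hD s (hSa s hs)).1.const_mul p)).sub h4).congr_deriv ?_
      simp only [hPdef, hG₁]
      ring)
    (fun s hs => (H s hs).2.2.1) (fun s hs => (hPder s hs).continuousAt)
  refine ⟨M, S₀ - p * Real.log (deriv g S₀) - ξ S₀, hM, X, fun y => deriv g (X y) / P (X y),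
    hXtop, fun y hy => ?_⟩
  obtain ⟨hy1, hy2, hy3⟩ := hX y hy
  have hXa := hSa _ hy1.le
  obtain ⟨hξ, -, hPge, -, -⟩ := H _ hy1.le
  have hPpos : 0 < P (X y) := by
    have : (1 : ℝ) / 2 ≤ P (X y) := hPge
    linarith
  have hgpos := hpos _ hXa
  have hQpos : 0 < deriv g (X y) / P (X y) := div_pos hgpos hPpos
  refine ⟨hXa, hQpos, ?_, ?_, ?_⟩
  · rw [show X y - p * Real.log (deriv g (X y)) - y = ξ (X y) by linarith]
    exact hξ
  · exact ((hI.1 _ hXa).1.comp y hy3).congr_deriv (div_eq_mul_inv _ _).symm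
  · have hQ : HasDerivAt (fun y => deriv g (X y) / P (X y))
        (-(κ / p) * (deriv g (X y) / P (X y)) *
          (Real.exp (ξ (X y)) * P (X y) ^ p - 1)) y := by
      refine (((hI.1 _ hXa).2.1.comp y hy3).div ((hPder _ hy1.le).comp y hy3)
        hPpos.ne').congr_deriv ?_
      simp only [hG₁, Function.comp]
      field_simp
      ring
    refine (hQ.rpow_const (Or.inl hQpos.ne')).congr_deriv ?_
    have e1 : Real.exp (X y - y) = Real.exp (ξ (X y)) * deriv g (X y) ^ p := by
      rw [Real.rpow_def_of_pos hgpos, ← Real.exp_add]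
      congr 1
      linarith
    have e2 : (deriv g (X y) / P (X y)) ^ p * P (X y) ^ p = deriv g (X y) ^ p := by
      rw [← Real.mul_rpow hQpos.le hPpos.le, div_mul_cancel₀ _ hPpos.ne']
    have e3 : (deriv g (X y) / P (X y)) * (deriv g (X y) / P (X y)) ^ (p - 1) =
        (deriv g (X y) / P (X y)) ^ p := by
      rw [Real.rpow_sub_one hQpos.ne', mul_div_cancel₀ _ hQpos.ne']
    rw [e1, ← e2, ← e3]
    field_simp
    ring

lemma hasDerivAt_radial_profile {p α θ γ κ c₀ r : ℝ} (hp : 1 ≤ p) (hθ : 0 < θ) (hαp : 0 < α - p)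
    (hκ : κ * θ = α - p) (hγ : γ + 1 = θ + α - p)
    (hc₀ : c₀ = Real.log (θ ^ p * (α - p))) (hr : 0 < r)
    {W Q E : ℝ → ℝ} (hQ : 0 < Q (c₀ - θ * Real.log r))
    (hW : HasDerivAt W (Q (c₀ - θ * Real.log r)) (c₀ - θ * Real.log r))
    (hQp : HasDerivAt (fun y => Q y ^ p)
      (κ * (Q (c₀ - θ * Real.log r) ^ p -
        Real.exp (E (c₀ - θ * Real.log r) - (c₀ - θ * Real.log r)))) (c₀ - θ * Real.log r)) :
    HasDerivAt (fun r => W (c₀ - θ * Real.log r))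
      (-(θ ^ p * r ^ (α - p) * Q (c₀ - θ * Real.log r) ^ p * r ^ (-α)) ^ (1 / p)) r ∧
    HasDerivAt (fun r => θ ^ p * r ^ (α - p) * Q (c₀ - θ * Real.log r) ^ p)
      (r ^ γ * Real.exp (E (c₀ - θ * Real.log r))) r := by
  have hp0 : 0 < p := by linarith
  have hy : HasDerivAt (fun r => c₀ - θ * Real.log r) (-(θ / r)) r := by
    refine ((hasDerivAt_const r c₀).sub ((Real.hasDerivAt_log hr.ne').const_mul θ)).congr_deriv ?_
    rw [zero_sub, div_eq_mul_inv]
  constructor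
  · refine (hW.comp r hy).congr_deriv ?_
    have e : θ ^ p * r ^ (α - p) * Q (c₀ - θ * Real.log r) ^ p * r ^ (-α) =
        (θ / r * Q (c₀ - θ * Real.log r)) ^ p := by
      rw [Real.mul_rpow (by positivity) hQ.le, Real.div_rpow hθ.le hr.le]
      have : r ^ (α - p) * r ^ (-α) * r ^ p = 1 := by
        rw [← Real.rpow_add hr, ← Real.rpow_add hr, show α - p + -α + p = 0 by ring,
          Real.rpow_zero]
      have h2 : r ^ p ≠ 0 := (Real.rpow_pos_of_pos hr p).ne'
      field_simp
      exact this
    rw [e, one_div, Real.rpow_rpow_inv (by positivity) hp0.ne']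
    ring
  · refine ((((Real.hasDerivAt_rpow_const (p := α - p) (Or.inl hr.ne')).const_mul
      (θ ^ p)).mul (hQp.comp r hy))).congr_deriv ?_
    simp only [Function.comp]
    set y := c₀ - θ * Real.log r with hydef
    have e1 : Real.exp (E y - y) = Real.exp (E y) * r ^ θ / (θ ^ p * (α - p)) := by
      rw [Real.exp_sub, hydef, Real.exp_sub, hc₀, Real.exp_log (by positivity),
        Real.rpow_def_of_pos hr, mul_comm (Real.log r) θ]
      field_simp
    have e2 : r ^ γ = r ^ (α - p) * r ^ θ / r := by
      rw [← Real.rpow_add hr, ← Real.rpow_sub_one hr.ne']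
      congr 1
      linarith
    have hθp : θ ^ p ≠ 0 := (Real.rpow_pos_of_pos hθ p).ne'
    have hk : κ = (α - p) / θ := by field_simp; linarith
    rw [e1, e2, Real.rpow_sub_one hr.ne', hk]
    field_simp
    ring

lemma hasDerivAt_ite_le {φ ψ : ℝ → ℝ} {a d : ℝ} (hφ : HasDerivAt φ d a)
    (hψ : HasDerivWithinAt ψ d (Ici a) a) (h : φ a = ψ a) :
    HasDerivAt (fun x => if x ≤ a then φ x else ψ x) d a := by
  rw [← hasDerivWithinAt_univ, ← Iic_union_Ici (a := a)]
  refine HasDerivWithinAt.union ?_ ?_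
  · exact hφ.hasDerivWithinAt.congr (fun x hx => if_pos hx) (if_pos le_rfl)
  · refine hψ.congr (fun x hx => ?_) ((if_pos le_rfl).trans h)
    rcases eq_or_lt_of_le (mem_Ici.1 hx) with rfl | hlt
    · exact (if_pos le_rfl).trans h
    · exact if_neg (not_le.2 hlt)

lemma exists_radial_extension {p α γ r₀ : ℝ} (hp : 1 ≤ p) (hγ : 0 < γ + 1)
    (hθ : 0 < γ + 1 + p - α) (hr₀ : 0 < r₀) {f U₀ V₀ : ℝ → ℝ} (hf : ContDiffOn ℝ 1 f (Ici 0))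
    (hf0 : ∀ u, 0 ≤ u → f 0 ≤ f u)
    (h₀ : ∀ r, 0 < r → r < r₀ → 0 < U₀ r ∧ 0 < V₀ r ∧
      HasDerivAt U₀ (-(V₀ r * r ^ (-α)) ^ (1 / p)) r ∧
      HasDerivAt V₀ (r ^ γ * Real.exp (f (U₀ r))) r) :
    ∃ r₁ R₁ R : ℝ, 0 < r₁ ∧ r₁ < R₁ ∧ R₁ < R ∧ ∃ U V : ℝ → ℝ,
      (∀ r, r < r₁ → U r = U₀ r) ∧ U R₁ = 0 ∧ (∀ r, 0 < r → r < R₁ → 0 < U r) ∧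
      ∀ r, 0 < r → r < R → 0 < V r ∧ HasDerivAt U (-(V r * r ^ (-α)) ^ (1 / p)) r ∧
        HasDerivAt V (r ^ γ * Real.exp (f (max (U r) 0))) r := by
  obtain ⟨r₁, hr₁, hr₁₀⟩ := exists_between hr₀
  obtain ⟨hu₁, hv₁, hU₁, hV₁⟩ := h₀ r₁ hr₁ hr₁₀
  obtain ⟨R, hR, A, B, hA, hB, hAR, hAB⟩ := exists_radial_continuation (α := α) hp hγ hθ hr₁ hu₁ hv₁
    (Real.exp_pos (f 0)) (F := fun u => Real.exp (f u))
    ((hf.mono Icc_subset_Ici_self).exp)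
    (fun u hu => Real.exp_le_exp.2 (hf0 u hu.1))
  have hUV : ∀ r, 0 < r → r < R →
      0 < (if r ≤ r₁ then V₀ r else B r) ∧
      HasDerivAt (fun x => if x ≤ r₁ then U₀ x else A x)
        (-((if r ≤ r₁ then V₀ r else B r) * r ^ (-α)) ^ (1 / p)) r ∧
      HasDerivAt (fun x => if x ≤ r₁ then V₀ x else B x)
        (r ^ γ * Real.exp (f (max (if r ≤ r₁ then U₀ r else A r) 0))) r := by
    intro r hr hrR
    rcases lt_trichotomy r r₁ with hlt | rfl | hgt
    · obtain ⟨a1, a2, a3, a4⟩ := h₀ r hr (hlt.trans hr₁₀)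
      have hev : ∀ᶠ x in nhds r, x ≤ r₁ := (gt_mem_nhds hlt).mono fun x hx => le_of_lt hx
      simp only [if_pos hlt.le, max_eq_left a1.le]
      exact ⟨a2, a3.congr_of_eventuallyEq (hev.mono fun x hx => if_pos hx),
        a4.congr_of_eventuallyEq (hev.mono fun x hx => if_pos hx)⟩
    · obtain ⟨-, -, b3, b4⟩ := hAB r (left_mem_Icc.2 hR.le)
      simp only [if_pos le_rfl, max_eq_left hu₁.le]
      rw [hB] at b3
      rw [hA, max_eq_left hu₁.le] at b4
      exact ⟨hv₁, hasDerivAt_ite_le hU₁ (b3.mono_of_mem_nhdsWithin (Icc_mem_nhdsGE hR)) hA.symm,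
        hasDerivAt_ite_le hV₁ (b4.mono_of_mem_nhdsWithin (Icc_mem_nhdsGE hR)) hB.symm⟩
    · obtain ⟨b1, -, b3, b4⟩ := hAB r ⟨hgt.le, hrR.le⟩
      have hev : ∀ᶠ x in nhds r, ¬ x ≤ r₁ := (lt_mem_nhds hgt).mono fun x hx => not_le.2 hx
      simp only [if_neg (not_le.2 hgt)]
      have hm := Icc_mem_nhds hgt hrR
      exact ⟨hv₁.trans_le b1,
        (b3.hasDerivAt hm).congr_of_eventuallyEq (hev.mono fun x hx => if_neg hx),
        (b4.hasDerivAt hm).congr_of_eventuallyEq (hev.mono fun x hx => if_neg hx)⟩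
  obtain ⟨R₁, hR₁, hAR₁⟩ := intermediate_value_Icc' hR.le
    (fun r hr => (hAB r hr).2.2.1.continuousWithinAt) ⟨hAR.le, hA ▸ hu₁.le⟩
  have hlt : r₁ < R₁ := lt_of_le_of_ne hR₁.1 (by rintro rfl; linarith)
  have hltR : R₁ < R := lt_of_le_of_ne hR₁.2 (by rintro rfl; linarith)
  have hzero : (if R₁ ≤ r₁ then U₀ R₁ else A R₁) = 0 := by rw [if_neg (not_le.2 hlt), hAR₁]
  refine ⟨r₁, R₁, R, hr₁, hlt, hltR, fun x => if x ≤ r₁ then U₀ x else A x,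
    fun x => if x ≤ r₁ then V₀ x else B x, fun r hr => if_pos hr.le, hzero, ?_, hUV⟩
  have hanti : StrictAntiOn (fun x => if x ≤ r₁ then U₀ x else A x) (Ioo 0 R) := by
    refine strictAntiOn_of_deriv_neg (convex_Ioo 0 R)
      (fun r hr => (hUV r hr.1 hr.2).2.1.continuousAt.continuousWithinAt) fun r hr => ?_
    rw [interior_Ioo] at hr
    obtain ⟨c1, c2, -⟩ := hUV r hr.1 hr.2
    rw [c2.deriv]
    have := hr.1
    exact neg_neg_of_pos (by positivity)
  intro r hr hrR
  have := hanti ⟨hr, hrR.trans hltR⟩ ⟨hr.trans hrR, hltR⟩ hrR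
  simpa only [hzero] using this

lemma contDiffOn_two_of_radial_system {p α γ R : ℝ} {f U V : ℝ → ℝ}
    (hf : ContinuousOn f (Ici 0))
    (hUV : ∀ r, 0 < r → r < R → 0 < V r ∧
      HasDerivAt U (-(V r * r ^ (-α)) ^ (1 / p)) r ∧
      HasDerivAt V (r ^ γ * Real.exp (f (max (U r) 0))) r) :
    ContDiffOn ℝ 2 U (Ioo 0 R) := by
  have hUc : ContinuousOn U (Ioo 0 R) := fun r hr =>
    (hUV r hr.1 hr.2).2.1.continuousAt.continuousWithinAt
  have hV : ContDiffOn ℝ 1 V (Ioo 0 R) := by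
    rw [show (1 : WithTop ℕ∞) = 0 + 1 by norm_num, contDiffOn_succ_iff_deriv_of_isOpen isOpen_Ioo]
    refine ⟨fun r hr => (hUV r hr.1 hr.2).2.2.differentiableAt.differentiableWithinAt, by simp, ?_⟩
    rw [contDiffOn_zero]
    have hc : ContinuousOn (fun r => r ^ γ * Real.exp (f (max (U r) 0))) (Ioo 0 R) := by
      refine ContinuousOn.mul ?_ (ContinuousOn.rexp ?_)
      · exact fun r hr => (Real.continuousAt_rpow_const r γ (Or.inl hr.1.ne')).continuousWithinAt
      · exact hf.comp (hUc.sup continuousOn_const) fun r _ => le_max_right (U r) 0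
    exact hc.congr fun r hr => (hUV r hr.1 hr.2).2.2.deriv
  rw [show (2 : WithTop ℕ∞) = 1 + 1 by norm_num, contDiffOn_succ_iff_deriv_of_isOpen isOpen_Ioo]
  refine ⟨fun r hr => (hUV r hr.1 hr.2).2.1.differentiableAt.differentiableWithinAt, by simp, ?_⟩
  have hc : ContDiffOn ℝ 1 (fun r => -(V r * r ^ (-α)) ^ (1 / p)) (Ioo 0 R) := by
    refine (ContDiffOn.rpow_const_of_ne (hV.mul ?_) fun r hr => ?_).neg
    · exact contDiffOn_id.rpow_const_of_ne fun r hr => hr.1.ne'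
    · have := (hUV r hr.1 hr.2).1
      have := hr.1
      positivity
  exact hc.congr fun r hr => (hUV r hr.1 hr.2).2.1.deriv

lemma radial_system_rescale {β α γ θ R₁ R : ℝ} (hβ : 0 ≤ β) (hθ : θ = γ + 2 + β - α)
    (hR₁ : 0 < R₁) (hR : R₁ < R) {f U V : ℝ → ℝ} (hf : ContinuousOn f (Ici 0))
    (hU0 : ∀ r, 0 < r → r ≤ R₁ → 0 ≤ U r)
    (hUV : ∀ r, 0 < r → r < R → 0 < V r ∧
      HasDerivAt U (-(V r * r ^ (-α)) ^ (1 / (β + 1))) r ∧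
      HasDerivAt V (r ^ γ * Real.exp (f (max (U r) 0))) r) :
    ContDiffOn ℝ 2 (fun r => U (R₁ * r)) (Ioc 0 1) ∧
      ∀ r ∈ Ioc (0 : ℝ) 1, HasDerivAt (fun x : ℝ => x ^ α *
        |deriv (fun r => U (R₁ * r)) x| ^ β * deriv (fun r => U (R₁ * r)) x)
          (-(R₁ ^ θ * r ^ γ * Real.exp (f (U (R₁ * r))))) r := by
  have hmaps : MapsTo (fun r => R₁ * r) (Ioc 0 1) (Ioo 0 R) := fun r hr =>
    ⟨mul_pos hR₁ hr.1, (mul_le_of_le_one_right hR₁.le hr.2).trans_lt hR⟩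
  refine ⟨(contDiffOn_two_of_radial_system hf hUV).comp
    (contDiff_const.mul contDiff_id).contDiffOn hmaps, fun r hr => ?_⟩
  have hlin : ∀ x, HasDerivAt (fun r => R₁ * r) R₁ x := fun x => by
    simpa using (hasDerivAt_id x).const_mul R₁
  have hev : ∀ᶠ x in nhds r, R₁ * x ∈ Ioo 0 R :=
    (hlin r).continuousAt.eventually (isOpen_Ioo.mem_nhds (hmaps hr))
  obtain ⟨-, -, h3⟩ := hUV _ (hmaps hr).1 (hmaps hr).2
  have hVr := ((h3.comp r (hlin r)).const_mul (-R₁ ^ (β + 1 - α)))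
  refine (hVr.congr_of_eventuallyEq ?_).congr_deriv ?_
  · filter_upwards [hev] with x hx
    obtain ⟨hV, hU, -⟩ := hUV _ hx.1 hx.2
    have hx0 : 0 < x := pos_of_mul_pos_right hx.1 hR₁.le
    have hd : deriv (fun r => U (R₁ * r)) x =
        -(R₁ * (V (R₁ * x) * (R₁ * x) ^ (-α)) ^ (1 / (β + 1))) :=
      (hU.comp x (hlin x)).deriv.trans (by ring)
    have hB : 0 < V (R₁ * x) * (R₁ * x) ^ (-α) := mul_pos hV (Real.rpow_pos_of_pos hx.1 _)
    set B := V (R₁ * x) * (R₁ * x) ^ (-α) with hBdef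
    have hQ : 0 < R₁ * B ^ (1 / (β + 1)) := by positivity
    have e1 : (R₁ * B ^ (1 / (β + 1))) ^ β * (R₁ * B ^ (1 / (β + 1))) = R₁ ^ (β + 1) * B := by
      rw [← Real.rpow_add_one hQ.ne', Real.mul_rpow hR₁.le (by positivity), one_div,
        Real.rpow_inv_rpow hB.le (by linarith)]
    have e2 : x ^ α * (R₁ * x) ^ (-α) = R₁ ^ (-α) := by
      rw [Real.mul_rpow hR₁.le hx0.le, Real.rpow_neg hx0.le]
      field_simp
    have e3 : R₁ ^ (β + 1 - α) = R₁ ^ (β + 1) * R₁ ^ (-α) := by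
      rw [← Real.rpow_add hR₁]
      congr 1
    rw [hd, abs_neg, abs_of_pos hQ]
    simp only [Function.comp]
    rw [e3, ← e2, mul_assoc, mul_neg, e1, hBdef]
    ring
  · have hle : R₁ * r ≤ R₁ := mul_le_of_le_one_right hR₁.le hr.2
    rw [max_eq_left (hU0 _ (hmaps hr).1 hle), Real.mul_rpow hR₁.le hr.1.le]
    have e : R₁ ^ θ = R₁ ^ (β + 1 - α) * R₁ ^ γ * R₁ := by
      rw [← Real.rpow_add hR₁, ← Real.rpow_add_one hR₁.ne', hθ]
      congr 1
      ring
    rw [e]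
    ring

lemma abs_taylor_two_le {φ φ₁ φ₂ : ℝ → ℝ} {a b B : ℝ}
    (h : ∀ σ ∈ uIcc a b, HasDerivAt φ (φ₁ σ) σ ∧ HasDerivAt φ₁ (φ₂ σ) σ ∧
      |φ₂ σ| * (b - a) ^ 2 ≤ B) :
    |φ b - φ a - φ₁ a * (b - a)| ≤ B := by
  have hB : 0 ≤ B := le_trans (by positivity) (h a left_mem_uIcc).2.2
  rcases eq_or_ne b a with rfl | hne
  · simpa using hB
  have hd : 0 < |b - a| := abs_pos.2 (sub_ne_zero.2 hne)
  have h2 : ∀ σ ∈ uIcc a b, ‖φ₁ σ - φ₁ a‖ ≤ B / |b - a| := by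
    intro σ hσ
    have := (convex_uIcc a b).norm_image_sub_le_of_norm_hasDerivWithin_le (f := φ₁) (f' := φ₂)
      (C := B / (b - a) ^ 2) (fun x hx => (h x hx).2.1.hasDerivWithinAt)
      (fun x hx => by
        rw [le_div_iff₀ (by rw [← sq_abs]; positivity)]
        exact (h x hx).2.2) left_mem_uIcc hσ
    refine this.trans ?_
    have h3 : ‖σ - a‖ ≤ |b - a| := abs_sub_left_of_mem_uIcc hσ
    calc B / (b - a) ^ 2 * ‖σ - a‖ ≤ B / (b - a) ^ 2 * |b - a| := by gcongr
      _ = B / |b - a| := by rw [← sq_abs (b - a)]; field_simp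
  have := (convex_uIcc a b).norm_image_sub_le_of_norm_hasDerivWithin_le
    (f := fun σ => φ σ - φ₁ a * σ) (f' := fun σ => φ₁ σ - φ₁ a) (C := B / |b - a|)
    (fun x hx => ((h x hx).1.sub
      ((hasDerivAt_id x).const_mul (φ₁ a))).hasDerivWithinAt.congr_deriv (by simp))
    h2 left_mem_uIcc right_mem_uIcc
  rw [Real.norm_eq_abs, Real.norm_eq_abs, div_mul_cancel₀ _ hd.ne'] at this
  rwa [show φ b - φ a - φ₁ a * (b - a) = φ b - φ₁ a * b - (φ a - φ₁ a * a) by ring]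

lemma abs_log_sub_log_le {x y : ℝ} (hy : 0 < y) (h : |x - y| ≤ y / 2) :
    |Real.log x - Real.log y| ≤ 2 * (|x - y| / y) := by
  have hx : y / 2 ≤ x := by linarith [(abs_le.1 h).1]
  have hx0 : 0 < x := by linarith
  rw [← Real.log_div hx0.ne' hy.ne', abs_le]
  constructor
  · have h1 := Real.log_le_sub_one_of_pos (div_pos hy hx0)
    rw [← inv_div, Real.log_inv] at h1
    have h2 : (x / y)⁻¹ - 1 ≤ 2 * (|x - y| / y) := by
      rw [inv_div, div_sub_one hx0.ne', div_le_iff₀ hx0]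
      have h3 : y - x ≤ |x - y| := by rw [abs_sub_comm]; exact le_abs_self _
      have h4 : 2 * (|x - y| / y) * (y / 2) = |x - y| := by field_simp
      have h5 : 2 * (|x - y| / y) * (y / 2) ≤ 2 * (|x - y| / y) * x := by gcongr
      linarith
    linarith
  · have h1 := Real.log_le_sub_one_of_pos (div_pos hx0 hy)
    rw [div_sub_one hy.ne'] at h1
    have h2 : (x - y) / y ≤ |x - y| / y := by
      gcongr
      exact le_abs_self _
    have : 0 ≤ |x - y| / y := by positivity
    linarith

lemma eventually_abs_shift_sub_le {G G₁ : ℝ → ℝ} {p M : ℝ} (hp : 0 < p) (hM : 0 < M)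
    (hG : G =o[atTop] fun t : ℝ => t) (h0 : Tendsto G₁ atTop (nhds 0)) {ε : ℝ} (hε : 0 < ε)
    (hε1 : ε ≤ 1) (c : ℝ) :
    ∀ᶠ s in atTop, ∀ y, |s - p * G s - y| ≤ M * |G₁ s| →
      |y + c - s| ≤ ε * s ∧ |y + c - s| ≤ ε * (y + c) := by
  have h1 : ∀ᶠ t in atTop, |G₁ t| < 1 / M := by
    filter_upwards [h0.eventually (Metric.ball_mem_nhds 0 (one_div_pos.2 hM))] with t ht
    simpa using Metric.mem_ball.1 ht
  filter_upwards [h1, hG.def (show 0 < ε / (4 * p) by positivity), eventually_gt_atTop 0,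
    eventually_ge_atTop (4 * (|c| + 1) / ε)] with s hs1 hs2 hs0 hs3 y hy
  rw [Real.norm_eq_abs, Real.norm_eq_abs, abs_of_pos hs0] at hs2
  rw [div_le_iff₀ hε] at hs3
  rw [lt_div_iff₀ hM] at hs1
  have h2 : |p * G s| ≤ ε / 4 * s := by
    rw [abs_mul, abs_of_pos hp]
    calc p * |G s| ≤ p * (ε / (4 * p) * s) := by gcongr
      _ = ε / 4 * s := by field_simp
  have h3 : |y + c - s| ≤ ε / 2 * s := by
    have e1 := abs_le.1 hy
    have e2 := abs_le.1 h2
    have e3 := abs_le.1 (le_refl |c|)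
    rw [abs_le]
    constructor <;> nlinarith
  have h4 := abs_le.1 h3
  constructor
  · refine h3.trans ?_
    nlinarith
  · refine h3.trans ?_
    nlinarith

lemma log_deriv_uniform_bounds {g : ℝ → ℝ} {a : ℝ} (hpos : ∀ t ∈ Ioi a, 0 < deriv g t)
    (hA3 : ∀ h : ℝ → ℝ, (h =o[atTop] fun t : ℝ => t) →
      Tendsto (fun t => deriv g t / deriv g (t + h t)) atTop (nhds 1))
    (hA5d : ∀ h : ℝ → ℝ, (h =o[atTop] fun t : ℝ => t) →
      (fun t => deriv (deriv g) (t + h t)) =O[atTop] fun t => deriv (deriv g) t) :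
    ∃ δ C t₀ : ℝ, 0 < δ ∧ δ ≤ 1 / 2 ∧ 1 ≤ C ∧ 0 < t₀ ∧ a < t₀ / 2 ∧
      ∀ t, t₀ ≤ t → ∀ s, |s - t| ≤ δ * t →
      deriv g s ≤ C * deriv g t ∧ |deriv (deriv g) s| ≤ C * |deriv (deriv g) t| := by
  obtain ⟨δ₁, C₁, t₁, hδ₁, hC₁, h₁⟩ := exists_uniform_bound_of_isLittleO (k := deriv g)
    fun h hh => isBigO_of_tendsto_div_one (hA3 h hh)
  obtain ⟨δ₂, C₂, t₂, hδ₂, hC₂, h₂⟩ := exists_uniform_bound_of_isLittleO hA5d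
  refine ⟨min (min δ₁ δ₂) (1 / 2), max (max C₁ C₂) 1, max (max t₁ t₂) (2 * |a| + 1),
    by positivity, min_le_right _ _, le_max_right _ _, ?_, ?_, fun t ht s hs => ?_⟩
  · exact lt_max_of_lt_right (by positivity)
  · have := le_max_right (max t₁ t₂) (2 * |a| + 1)
    linarith [le_abs_self a]
  · have ht1 : t₁ ≤ t := ((le_max_left _ _).trans (le_max_left _ _)).trans ht
    have ht2 : t₂ ≤ t := ((le_max_right _ _).trans (le_max_left _ _)).trans ht
    have ht3 : 2 * |a| + 1 ≤ t := (le_max_right _ _).trans ht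
    have ht0 : 0 ≤ t := by linarith [abs_nonneg a]
    have hta : a < t := by linarith [le_abs_self a, abs_nonneg a]
    constructor
    · refine (le_abs_self _).trans ((h₁ t ht1 s (hs.trans ?_)).trans ?_)
      · gcongr
        exact (min_le_left _ _).trans (min_le_left _ _)
      · rw [abs_of_pos (hpos t hta)]
        exact mul_le_mul_of_nonneg_right ((le_max_left _ _).trans (le_max_left _ _))
          (hpos t hta).le
    · refine (h₂ t ht2 s (hs.trans ?_)).trans ?_
      · gcongr
        exact (min_le_left _ _).trans (min_le_right _ _)
      · exact mul_le_mul_of_nonneg_right ((le_max_right _ _).trans (le_max_left _ _))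
          (abs_nonneg _)

lemma sq_le_of_abs_sub_le {x m K : ℝ} (h : |x - m| ≤ K) : x ^ 2 ≤ 2 * m ^ 2 + 2 * K ^ 2 := by
  have h1 := sq_le_sq' (by linarith [abs_nonneg (x - m), (abs_le.1 h).1]) (abs_le.1 h).2
  nlinarith [sq_nonneg (x - 2 * m)]

set_option maxHeartbeats 800000 in
lemma exists_profile_expansion {g : ℝ → ℝ} {a p M : ℝ} (hp : 0 < p) (hM : 0 < M)
    (hg : ContDiffOn ℝ 4 g (Ioi a)) (hpos : ∀ t ∈ Ioi a, 0 < deriv g t)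
    (h0 : Tendsto (fun t => deriv (deriv g) t / deriv g t) atTop (nhds 0))
    (hA3 : ∀ h : ℝ → ℝ, (h =o[atTop] fun t : ℝ => t) →
      Tendsto (fun t => deriv g t / deriv g (t + h t)) atTop (nhds 1))
    (hA5a : ∀ n : ℕ, n ≤ 2 →
      (fun t => deriv (deriv (deriv g)) t * Real.log (deriv g t) ^ n)
        =O[atTop] fun t => deriv (deriv g) t)
    (hA5d : ∀ h : ℝ → ℝ, (h =o[atTop] fun t : ℝ => t) →
      (fun t => deriv (deriv g) (t + h t)) =O[atTop] fun t => deriv (deriv g) t) (c c' : ℝ) :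
    ∃ K : ℝ, ∀ᶠ s in atTop, ∀ y,
      |s - p * Real.log (deriv g s) - y| ≤ M * |deriv (deriv g) s / deriv g s| →
      |g s - g (y + p * Real.log (deriv g (y + c) +
        p * deriv (deriv g) (y + c) * Real.log (deriv g (y + c))))| ≤
        K * |deriv (deriv g) (y + c')| := by
  obtain ⟨δ, C, t₀, hδ, hδ2, hC, ht₀, hat₀, hunif⟩ := log_deriv_uniform_bounds hpos hA3 hA5d
  have hI := (hasDerivAt_iterated_deriv hg).1
  have hGo : (fun t => Real.log (deriv g t)) =o[atTop] fun t : ℝ => t := by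
    refine isLittleO_id_of_hasDerivAt_of_tendsto_zero ?_ h0
    filter_upwards [eventually_gt_atTop a] with t ht using (hasDerivAt_log_deriv hg hpos ht).1
  have near := fun c => eventually_abs_shift_sub_le hp hM hGo h0 hδ (hδ2.trans (by norm_num)) c
  obtain ⟨E₀, hE₀, h5₀⟩ := (hA5a 0 (by norm_num)).exists_pos
  obtain ⟨E₂, hE₂, h5₂⟩ := (hA5a 2 le_rfl).exists_pos
  obtain ⟨t₁, ht₁⟩ := eventually_atTop.1 (h5₀.bound.and h5₂.bound)
  have hlogC : 0 ≤ Real.log C := Real.log_nonneg hC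
  obtain ⟨K₁, hK₁⟩ : ∃ k, k = |c| + 1 + p * Real.log C := ⟨_, rfl⟩
  obtain ⟨K₂, hK₂⟩ : ∃ k, k = (2 * p ^ 2 * E₂ + 2 * K₁ ^ 2 * E₀) * C := ⟨_, rfl⟩
  obtain ⟨K₃, hK₃⟩ : ∃ k, k = K₁ * C + K₂ := ⟨_, rfl⟩
  have hK₁0 : 0 < K₁ := by rw [hK₁]; positivity
  have hK₂0 : 0 < K₂ := by rw [hK₂]; positivity
  have hK₃0 : 0 < K₃ := by rw [hK₃]; positivity
  obtain ⟨K₄, hK₄⟩ : ∃ k, k = M + 2 * p * K₃ := ⟨_, rfl⟩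
  have hK₄0 : 0 < K₄ := by rw [hK₄]; positivity
  have hsmall : ∀ κ > 0, ∀ᶠ t in atTop, κ * |deriv (deriv g) t / deriv g t| ≤ 1 := by
    intro κ hκ
    filter_upwards [h0.eventually (Metric.ball_mem_nhds 0 (one_div_pos.2 hκ))] with t ht
    have : |deriv (deriv g) t / deriv g t| < 1 / κ := by
      simpa only [Metric.mem_ball, dist_zero_right, Real.norm_eq_abs] using ht
    rw [lt_div_iff₀ hκ] at this
    linarith
  refine ⟨C * K₄ * C, ?_⟩
  filter_upwards [near c, near c', hsmall M hM, hsmall (2 * K₃) (by positivity),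
    hsmall K₄ hK₄0, eventually_ge_atTop (2 * t₀), eventually_ge_atTop (2 * t₁),
    eventually_ge_atTop (1 / δ)] with s hn hn' hsM hs3 hs4 hst₀ hst₁ hsδ y hy
  have hs0 : 0 < s := by linarith
  set τ := y + c with hτ
  obtain ⟨hτs, hτ'⟩ := hn y hy
  obtain ⟨hys, hy'⟩ := hn' y hy
  have has : ∀ σ, s / 2 ≤ σ → a < σ := fun σ hσ => by linarith
  have hgs : 0 < deriv g s := hpos s (has s (by linarith))
  have hseg : ∀ σ ∈ uIcc τ s, s / 2 ≤ σ ∧ |σ - s| ≤ δ * s ∧ |s - σ| ≤ δ * σ := by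
    intro σ hσ
    have h1 : |s - σ| ≤ |s - τ| := abs_sub_right_of_mem_uIcc hσ
    rw [abs_sub_comm s τ] at h1
    rw [abs_sub_comm σ s]
    have h2 : min τ s ≤ σ := hσ.1
    have h3 := (abs_le.1 hτs).1
    have h4 : |τ - s| ≤ δ * min τ s := by
      rcases min_choice τ s with h | h <;> rw [h] <;> assumption
    have h5 : s / 2 ≤ min τ s := le_min (by nlinarith) (by linarith)
    exact ⟨h5.trans h2, h1.trans hτs, h1.trans (h4.trans (by gcongr))⟩
  have hGseg : ∀ σ ∈ uIcc τ s, |Real.log (deriv g σ) - Real.log (deriv g s)| ≤ Real.log C := by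
    intro σ hσ
    obtain ⟨h1, h2, h3⟩ := hseg σ hσ
    have hgσ := hpos σ (has σ h1)
    have h4 := Real.log_le_log hgσ (hunif s (by linarith) σ h2).1
    have h5 := Real.log_le_log hgs (hunif σ (by linarith) s h3).1
    rw [Real.log_mul (by positivity) (by positivity)] at h4 h5
    rw [abs_le]
    constructor <;> linarith
  have hd : |s - τ - p * Real.log (deriv g s)| ≤ |c| + 1 := by
    rw [show s - τ - p * Real.log (deriv g s) = (s - p * Real.log (deriv g s) - y) - c by
      rw [hτ]; ring]
    linarith [abs_sub (s - p * Real.log (deriv g s) - y) c]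
  have hdG : ∀ σ ∈ uIcc τ s, |s - τ - p * Real.log (deriv g σ)| ≤ K₁ := by
    intro σ hσ
    have h1 : |p * (Real.log (deriv g σ) - Real.log (deriv g s))| ≤ p * Real.log C := by
      rw [abs_mul, abs_of_pos hp]
      exact mul_le_mul_of_nonneg_left (hGseg σ hσ) hp.le
    rw [show s - τ - p * Real.log (deriv g σ) = (s - τ - p * Real.log (deriv g s)) -
      p * (Real.log (deriv g σ) - Real.log (deriv g s)) by ring]
    linarith [abs_sub (s - τ - p * Real.log (deriv g s))
      (p * (Real.log (deriv g σ) - Real.log (deriv g s)))]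
  have htaylor : |deriv g s - deriv g τ - deriv (deriv g) τ * (s - τ)| ≤
      K₂ * |deriv (deriv g) s| := by
    refine abs_taylor_two_le (φ₂ := deriv (deriv (deriv g))) fun σ hσ => ?_
    obtain ⟨h1, h2, -⟩ := hseg σ hσ
    refine ⟨(hI σ (has σ h1)).2.1, (hI σ (has σ h1)).2.2, ?_⟩
    obtain ⟨e1, e2⟩ := ht₁ σ (by linarith)
    simp only [pow_zero, mul_one, Real.norm_eq_abs, abs_mul, abs_pow, sq_abs] at e1 e2
    have e3 := (hunif s (by linarith) σ h2).2
    set L := Real.log (deriv g σ)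
    have e4 : (s - τ) ^ 2 ≤ 2 * p ^ 2 * L ^ 2 + 2 * K₁ ^ 2 := by
      rw [mul_assoc, ← mul_pow]
      exact sq_le_of_abs_sub_le (hdG σ hσ)
    calc |deriv (deriv (deriv g)) σ| * (s - τ) ^ 2
        ≤ |deriv (deriv (deriv g)) σ| * (2 * p ^ 2 * L ^ 2 + 2 * K₁ ^ 2) := by gcongr
      _ = 2 * p ^ 2 * (|deriv (deriv (deriv g)) σ| * L ^ 2) +
          2 * K₁ ^ 2 * |deriv (deriv (deriv g)) σ| := by ring
      _ ≤ 2 * p ^ 2 * (E₂ * |deriv (deriv g) σ|) + 2 * K₁ ^ 2 * (E₀ * |deriv (deriv g) σ|) := by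
          gcongr
      _ = (2 * p ^ 2 * E₂ + 2 * K₁ ^ 2 * E₀) * |deriv (deriv g) σ| := by ring
      _ ≤ (2 * p ^ 2 * E₂ + 2 * K₁ ^ 2 * E₀) * (C * |deriv (deriv g) s|) := by gcongr
      _ = K₂ * |deriv (deriv g) s| := by rw [hK₂]; ring
  set A := deriv g τ + p * deriv (deriv g) τ * Real.log (deriv g τ) with hA
  have hAs : |A - deriv g s| ≤ K₃ * |deriv (deriv g) s| := by
    have h1 := (hunif s (by linarith) τ hτs).2
    have h2 : |deriv (deriv g) τ * (s - τ - p * Real.log (deriv g τ))| ≤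
        C * |deriv (deriv g) s| * K₁ := by
      rw [abs_mul]
      exact mul_le_mul h1 (hdG τ left_mem_uIcc) (abs_nonneg _) (by positivity)
    rw [abs_sub_comm, show deriv g s - A =
      (deriv g s - deriv g τ - deriv (deriv g) τ * (s - τ)) +
        deriv (deriv g) τ * (s - τ - p * Real.log (deriv g τ)) by rw [hA]; ring]
    refine (abs_add_le _ _).trans ((add_le_add htaylor h2).trans (le_of_eq ?_))
    rw [hK₃]
    ring
  have habs : |deriv (deriv g) s / deriv g s| = |deriv (deriv g) s| / deriv g s := by
    rw [abs_div, abs_of_pos hgs]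
  rw [habs] at hs3 hs4 hsM hy
  have hlog : |Real.log A - Real.log (deriv g s)| ≤
      2 * (K₃ * |deriv (deriv g) s| / deriv g s) := by
    refine (abs_log_sub_log_le hgs (hAs.trans ?_)).trans (by gcongr)
    rw [← mul_div_assoc, div_le_one hgs] at hs3
    linarith
  set Z := y + p * Real.log A with hZ
  have hZs : |Z - s| ≤ K₄ * (|deriv (deriv g) s| / deriv g s) := by
    have h1 : |p * (Real.log A - Real.log (deriv g s))| ≤
        p * (2 * (K₃ * |deriv (deriv g) s| / deriv g s)) := by
      rw [abs_mul, abs_of_pos hp]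
      exact mul_le_mul_of_nonneg_left hlog hp.le
    rw [show Z - s = p * (Real.log A - Real.log (deriv g s)) -
      (s - p * Real.log (deriv g s) - y) by rw [hZ]; ring]
    refine (abs_sub _ _).trans ((add_le_add h1 hy).trans (le_of_eq ?_))
    rw [hK₄]
    ring
  have hgZ : |g s - g Z| ≤ C * deriv g s * |s - Z| := by
    have hζ : ∀ ζ ∈ uIcc Z s, s / 2 ≤ ζ ∧ |ζ - s| ≤ δ * s := by
      intro ζ hζ
      have h1 : |s - ζ| ≤ |s - Z| := abs_sub_right_of_mem_uIcc hζ
      rw [abs_sub_comm s ζ, abs_sub_comm s Z] at h1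
      rw [div_le_iff₀ hδ, mul_comm] at hsδ
      have h2 : |ζ - s| ≤ δ * s := by linarith
      have := (abs_le.1 h2).1
      exact ⟨by nlinarith, h2⟩
    refine (convex_uIcc Z s).norm_image_sub_le_of_norm_hasDerivWithin_le (f' := deriv g)
      (fun x hx => (hI x (has x (hζ x hx).1)).1.hasDerivWithinAt) (fun x hx => ?_)
      left_mem_uIcc right_mem_uIcc
    rw [Real.norm_eq_abs, abs_of_pos (hpos x (has x (hζ x hx).1))]
    exact (hunif s (by linarith) x (hζ x hx).2).1
  have hfin := (hunif (y + c') (by nlinarith [(abs_le.1 hys).1]) s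
    (by rw [abs_sub_comm]; exact hy')).2
  calc |g s - g Z| ≤ C * deriv g s * |s - Z| := hgZ
    _ ≤ C * deriv g s * (K₄ * (|deriv (deriv g) s| / deriv g s)) := by
        rw [abs_sub_comm s Z]
        gcongr
    _ = C * K₄ * |deriv (deriv g) s| := by field_simp
    _ ≤ C * K₄ * (C * |deriv (deriv g) (y + c')|) := by gcongr
    _ = C * K₄ * C * |deriv (deriv g) (y + c')| := by ring

/-- Theorem 1.1 / 2.1: under assumptions (A1)–(A6) there exist `λ* > 0` and a radial
singular solution `u*` of `L(u) + λ* e^{f(u)} = 0` on the unit ball, positive in the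
interior, vanishing at `r = 1`, blowing up at the origin, with the sharp asymptotics
`u*(r) = g(Z(r)) + O(g''(−θ ln r))` as `r → 0+`. -/
theorem stmt_0 (α β γ θ : ℝ) (hθ : θ = γ + 2 + β - α) (f g : ℝ → ℝ)
    -- (A1): f is C⁴ on [0,∞), increasing, tending to +∞; g is its inverse
    (hf : ContDiffOn ℝ 4 f (Ici 0))
    (hf' : ∀ u ∈ Ici (0:ℝ), 0 < deriv f u)
    (hftop : Tendsto f atTop atTop)
    (hgf : ∀ u ∈ Ici (0:ℝ), g (f u) = u)
    (hfg : ∀ t ∈ Ici (f 0), f (g t) = t)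
    -- (A2)
    (hA2a : Tendsto (fun t => deriv (deriv g) t) atTop (nhds 0))
    (hA2b : ∀ ε : ℝ → ℝ, (ε =O[atTop] fun t => deriv (deriv g) t) →
      Tendsto (fun t => f (g t + ε t) / t) atTop (nhds 1))
    -- (A3)
    (hA3 : ∀ h : ℝ → ℝ, (h =o[atTop] fun t : ℝ => t) →
      Tendsto (fun t => deriv g t / deriv g (t + h t)) atTop (nhds 1))
    -- (A4)
    (hA4 : Tendsto (fun t => deriv (deriv g) t / deriv g t * Real.log (deriv g t))
      atTop (nhds 0))
    -- (A5)
    (hA5a : ∀ n : ℕ, n ≤ 2 →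
      (fun t => deriv (deriv (deriv g)) t * Real.log (deriv g t) ^ n)
        =O[atTop] fun t => deriv (deriv g) t)
    (hA5b : (fun t => deriv (deriv (deriv (deriv g))) t * Real.log (deriv g t))
        =O[atTop] fun t => deriv (deriv g) t)
    (hA5c : ∃ C : ℝ, ∀ᶠ t in atTop, ∀ s, t ≤ s →
      |deriv (deriv g) s| ≤ C * |deriv (deriv g) t|)
    (hA5d : ∀ h : ℝ → ℝ, (h =o[atTop] fun t : ℝ => t) →
      (fun t => deriv (deriv g) (t + h t)) =O[atTop] fun t => deriv (deriv g) t)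
    -- (A6)
    (hαβ : α > β + 1) (hβ : 0 ≤ β) (hθpos : 0 < θ)
    :
    ∃ lam : ℝ, 0 < lam ∧ ∃ u : ℝ → ℝ,
      ContDiffOn ℝ 2 u (Ioc 0 1) ∧
      (∀ r ∈ Ioc (0:ℝ) 1,
        HasDerivAt (fun x : ℝ => x ^ α * |deriv u x| ^ β * deriv u x)
          (-(lam * r ^ γ * Real.exp (f (u r)))) r) ∧
      u 1 = 0 ∧ (∀ r ∈ Ioo (0:ℝ) 1, 0 < u r) ∧
      Tendsto u (nhdsWithin 0 (Ioi 0)) atTop ∧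
      (fun r => u r -
          g (Real.log (θ ^ (β + 1) * (α - β - 1)) - Real.log lam - θ * Real.log r +
            (β + 1) * Real.log (deriv g (Real.log ((β + 1) / (lam * r ^ θ))) +
              (β + 1) * deriv (deriv g) (Real.log ((β + 1) / (lam * r ^ θ))) *
                Real.log (deriv g (Real.log ((β + 1) / (lam * r ^ θ)))))))
        =O[nhdsWithin 0 (Ioi 0)] fun r => deriv (deriv g) (-θ * Real.log r) := by
  obtain ⟨hg, hgs⟩ := inverse_facts hf hf' hftop hgf
  have hpos : ∀ t ∈ Ioi (f 0), 0 < deriv g t := fun t ht => (hgs t ht).2.2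
  have h0 := tendsto_log_deriv_zero ((eventually_gt_atTop (f 0)).mono hpos) hA2a hA4
  have h3 : deriv (deriv (deriv g)) =O[atTop] deriv (deriv g) := by
    simpa using hA5a 0 (by norm_num)
  have hp : 1 ≤ β + 1 := by linarith
  have hαp : 0 < α - (β + 1) := by linarith
  obtain ⟨M, y₀, hM, X, Q, hXtop, hX⟩ := exists_singular_profile (p := β + 1)
    (div_pos hαp hθpos) hp hg hpos h0 h3 hA5c
  obtain ⟨c₀, hc₀⟩ : ∃ c, c = Real.log (θ ^ (β + 1) * (α - β - 1)) := ⟨_, rfl⟩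
  have hfmono : MonotoneOn f (Ici 0) :=
    monotoneOn_of_deriv_nonneg (convex_Ici 0) hf.continuousOn
      ((hf.differentiableOn (by norm_num)).mono interior_subset)
      fun u hu => (hf' u (interior_subset hu)).le
  have hlocal : ∀ r, 0 < r → r < Real.exp ((c₀ - y₀) / θ) → y₀ < c₀ - θ * Real.log r := by
    intro r hr hr'
    have := (Real.log_lt_iff_lt_exp hr).2 hr'
    rw [lt_div_iff₀ hθpos] at this
    linarith
  obtain ⟨r₁, R₁, R, hr₁, hr₁R₁, hR₁R, U, V, hUeq, hUR₁, hUpos, hUV⟩ :=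
    exists_radial_extension (p := β + 1) (α := α) (γ := γ) hp (by linarith) (by linarith)
      (Real.exp_pos ((c₀ - y₀) / θ)) (hf.of_le (by norm_num))
      (fun u hu => hfmono self_mem_Ici hu hu)
      (U₀ := fun r => g (X (c₀ - θ * Real.log r)))
      (V₀ := fun r => θ ^ (β + 1) * r ^ (α - (β + 1)) * Q (c₀ - θ * Real.log r) ^ (β + 1))
      (fun r hr hr' => by
        obtain ⟨k1, k2, -, k4, k5⟩ := hX _ (hlocal r hr hr')
        obtain ⟨m1, m2, -⟩ := hgs _ k1
        have hrad := hasDerivAt_radial_profile (γ := γ) hp hθpos hαp (div_mul_cancel₀ _ hθpos.ne')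
          (by linarith) (by rw [hc₀, sub_sub]) hr k2 k4 k5
        rw [m2]
        exact ⟨m1, by positivity, hrad⟩)
  have hR₁ : 0 < R₁ := hr₁.trans hr₁R₁
  obtain ⟨hC2, hode⟩ := radial_system_rescale hβ hθ hR₁ hR₁R hf.continuousOn
    (fun r hr hr' => (eq_or_lt_of_le hr').elim (fun h => by rw [h, hUR₁])
      fun h => (hUpos r hr h).le) hUV
  have hpos' : ∀ᶠ r : ℝ in nhdsWithin 0 (Ioi 0), 0 < r := self_mem_nhdsWithin
  have hsmall : ∀ᶠ r : ℝ in nhdsWithin 0 (Ioi 0), U (R₁ * r) =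
      g (X (c₀ - θ * Real.log (R₁ * r))) := by
    filter_upwards [nhdsWithin_le_nhds (gt_mem_nhds (div_pos hr₁ hR₁))] with r hr
    rw [lt_div_iff₀ hR₁, mul_comm] at hr
    exact hUeq _ hr
  have hytop : Tendsto (fun r => c₀ - θ * Real.log (R₁ * r)) (nhdsWithin 0 (Ioi 0)) atTop := by
    have h1 : Tendsto (fun r : ℝ => (c₀ - θ * Real.log R₁) + (-θ) * Real.log r)
        (nhdsWithin 0 (Ioi 0)) atTop :=
      tendsto_atTop_add_const_left _ _
        (Real.tendsto_log_nhdsGT_zero.const_mul_atBot_of_neg (neg_neg_of_pos hθpos))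
    refine h1.congr' ?_
    filter_upwards [hpos'] with r hr
    rw [Real.log_mul hR₁.ne' (ne_of_gt hr)]
    ring
  have hgtop : Tendsto g atTop atTop := by
    refine tendsto_atTop.2 fun b => ?_
    filter_upwards [eventually_gt_atTop (f 0), eventually_gt_atTop (f (max b 0))] with t ht htb
    by_contra! hlt
    have := hfmono (hgs t ht).1.le (le_max_right b 0) (hlt.le.trans (le_max_left b 0))
    rw [(hgs t ht).2.1] at this
    linarith
  refine ⟨R₁ ^ θ, Real.rpow_pos_of_pos hR₁ θ, fun r => U (R₁ * r), hC2, hode, ?_, ?_, ?_, ?_⟩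
  · simpa using hUR₁
  · exact fun r hr => hUpos _ (mul_pos hR₁ hr.1) (mul_lt_of_lt_one_right hR₁ hr.2)
  · exact (hgtop.comp (hXtop.comp hytop)).congr' (hsmall.mono fun r hr => hr.symm)
  · obtain ⟨K, hK⟩ := exists_profile_expansion (p := β + 1) (by linarith) hM hg hpos h0 hA3 hA5a
      hA5d (Real.log (β + 1) - c₀) (θ * Real.log R₁ - c₀)
    refine IsBigO.of_bound K ?_
    filter_upwards [hpos', hsmall, hytop.eventually_gt_atTop y₀,
      (hXtop.comp hytop).eventually hK] with r hr hUr hy hKr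
    obtain ⟨-, -, k3, -, -⟩ := hX _ hy
    have hlog : Real.log (R₁ * r) = Real.log R₁ + Real.log r := Real.log_mul hR₁.ne' hr.ne'
    have e1 : Real.log ((β + 1) / (R₁ ^ θ * r ^ θ)) =
        c₀ - θ * Real.log (R₁ * r) + (Real.log (β + 1) - c₀) := by
      rw [← Real.mul_rpow hR₁.le hr.le, Real.log_div (by positivity)
        (Real.rpow_pos_of_pos (mul_pos hR₁ hr) θ).ne', Real.log_rpow (mul_pos hR₁ hr)]
      ring
    have e2 : -θ * Real.log r = c₀ - θ * Real.log (R₁ * r) + (θ * Real.log R₁ - c₀) := by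
      rw [hlog]
      ring
    have e3 : Real.log (θ ^ (β + 1) * (α - β - 1)) - Real.log (R₁ ^ θ) - θ * Real.log r =
        c₀ - θ * Real.log (R₁ * r) := by
      rw [hc₀, hlog, Real.log_rpow hR₁]
      ring
    rw [Real.norm_eq_abs, Real.norm_eq_abs, e1, e2, e3, hUr]
    exact hKr _ k3
end

section
/- Assume α > β + 1, β ≥ 0 and θ := γ + 2 + β − α > 0. Set λ* = θ^{β+1}(α − β − 1) and u*(r) = −θ ln r for r > 0. Then for every r > 0, (r^α |u*'(r)|^β u*'(r))' = − λ* r^γ exp(u*(r)); moreover u*(1) = 0, u*(r) > 0 for r ∈ (0,1), and u*(r) → +∞ as r → 0+. Hence (u*, λ*) is a radial singular solution of L(u) + λ e^{u} = 0 on the unit ball. -/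
open Filter Set Real

/-- Explicit radial singular solution of the Liouville–Bratu–Gelfand problem
`L(u) + λ e^u = 0` on the unit ball, where `L(u)(r) = r^{−γ}(r^α |u'|^β u')'`:
with `θ = γ + 2 + β − α`, `λ* = θ^{β+1}(α − β − 1)` and `u*(r) = −θ ln r`. -/
theorem stmt_1 (α β γ θ : ℝ) (hθ : θ = γ + 2 + β - α)
    (hαβ : α > β + 1) (hβ : 0 ≤ β) (hθpos : 0 < θ)
    (lam : ℝ) (hlam : lam = θ ^ (β + 1) * (α - β - 1))
    (u : ℝ → ℝ) (hu : ∀ r, u r = -θ * Real.log r) :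
    (∀ r, 0 < r →
      HasDerivAt (fun x : ℝ => x ^ α * |deriv u x| ^ β * deriv u x)
        (-(lam * r ^ γ * Real.exp (u r))) r) ∧
    u 1 = 0 ∧ (∀ r ∈ Ioo (0:ℝ) 1, 0 < u r) ∧
    Tendsto u (nhdsWithin 0 (Ioi 0)) atTop := by
  have hu' : u = fun r => -θ * Real.log r := funext hu
  have hderiv : ∀ x, deriv u x = -θ * x⁻¹ := fun x => by
    rw [hu', deriv_const_mul_field, Real.deriv_log]
  refine ⟨fun r hr => ?_, by simp [hu], fun r hr => ?_, ?_⟩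
  · have hpow : HasDerivAt (fun x : ℝ => -θ ^ (β + 1) * x ^ (α - β - 1))
        (-θ ^ (β + 1) * ((α - β - 1) * r ^ (α - β - 1 - 1))) r :=
      (Real.hasDerivAt_rpow_const (Or.inl hr.ne')).const_mul _
    have hexp : Real.exp (u r) = r ^ (-θ) := by
      rw [hu, Real.rpow_def_of_pos hr, mul_comm]
    have hval : -θ ^ (β + 1) * ((α - β - 1) * r ^ (α - β - 1 - 1)) =
        -(lam * r ^ γ * Real.exp (u r)) := by
      rw [hexp, mul_assoc lam, ← Real.rpow_add hr, hlam,
        show γ + -θ = α - β - 1 - 1 by rw [hθ]; ring]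
      ring
    rw [← hval]
    refine hpow.congr_of_eventuallyEq ?_
    filter_upwards [Ioi_mem_nhds hr] with x (hx : 0 < x)
    have habs : |-θ * x⁻¹| = θ * x⁻¹ := by
      rw [neg_mul, abs_neg, abs_of_pos (by positivity)]
    rw [hderiv, habs, Real.mul_rpow hθpos.le (by positivity), Real.inv_rpow hx.le,
      Real.rpow_add_one hθpos.ne', Real.rpow_sub_one hx.ne', Real.rpow_sub hx]
    field_simp
  · rw [hu]
    exact mul_pos_of_neg_of_neg (neg_neg_of_pos hθpos) (Real.log_neg hr.1 hr.2)
  · rw [hu']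
    exact Real.tendsto_log_nhdsGT_zero.const_mul_atBot_of_neg (neg_neg_of_pos hθpos)
end
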